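/- Let m ≥ 2 and let h, f : S^{m-1} → ℝ be smooth functions. If there exists a non-negative Legendrian isotopy {Λ_t}_{t∈[0,1]} in E = J¹(S^{m-1}) with Λ_0 the 1-jet graph Λ^h and Λ_1 the 1-jet graph Λ^f, then h(q) ≤ f(q) for every q ∈ S^{m-1}. -/

import Mathlib

/-!
STATEMENT 6: If a non-negative Legendrian isotopy in `E = J¹(S^{m-1})` connects the
1-jet graph `Λ^h` to the 1-jet graph `Λ^f` of smooth functions `h, f : S^{m-1} → ℝ`,
then `h ≤ f` on `S^{m-1}` (Corollary 5.5 of the paper for `L = S^{m-1}`).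

Conventions for representing Legendrian isotopies, smooth functions on the sphere,
the 1-jet space `E = {(q,p,u) ∈ S^{m-1} × ℝ^m × ℝ : ⟨p,q⟩ = 0}`, 1-jet graphs and
non-negativity are as in Statement 5: an isotopy is recorded by a smooth ambient map
`F : ℝ^m × ℝ → ℝ^m × ℝ^m × ℝ` parameterised by the sphere (with `F₀` the tautological
parameterisation of `Λ^h`), whose time slices are embedded Legendrian submanifolds.
-/

noncomputable section

open Set Metric
open scoped RealInnerProductSpace

/-- The unit sphere `S^{m-1} ⊂ ℝ^m`. -/
def sph (m : ℕ) : Set (EuclideanSpace ℝ (Fin m)) := Metric.sphere (0 : EuclideanSpace ℝ (Fin m)) 1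

/-- Ambient model `ℝ^m × ℝ^m × ℝ` of the 1-jet space `J¹(S^{m-1})`. -/
abbrev JetSp (m : ℕ) := EuclideanSpace ℝ (Fin m) × EuclideanSpace ℝ (Fin m) × ℝ

/-- `F : ℝ^m × ℝ → ℝ^m × ℝ^m × ℝ` represents a Legendrian isotopy `{Λ_t}_{t∈[0,1]}` in
`E = J¹(S^{m-1})` parameterised by the sphere: it is smooth, maps `S^{m-1} × [0,1]` into
`E`, each `F_t|_{S^{m-1}}` is an injective immersion (hence an embedding of the compact
sphere) onto `Λ_t`, and each `Λ_t` is Legendrian: every tangent vector `(w,v,a)` of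
`Λ_t` satisfies `a = ⟨p,w⟩`. -/
structure IsLegIsotopyJet (m : ℕ) (F : EuclideanSpace ℝ (Fin m) × ℝ → JetSp m) : Prop where
  smooth : ContDiff ℝ (⊤ : ℕ∞) F
  mem_sphere : ∀ s ∈ sph m, ∀ t ∈ Icc (0:ℝ) 1, (F (s, t)).1 ∈ sph m
  mem_jet : ∀ s ∈ sph m, ∀ t ∈ Icc (0:ℝ) 1, ⟪(F (s, t)).2.1, (F (s, t)).1⟫ = 0
  inj : ∀ t ∈ Icc (0:ℝ) 1, InjOn (fun s => F (s, t)) (sph m)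
  imm : ∀ t ∈ Icc (0:ℝ) 1, ∀ s ∈ sph m, ∀ v : EuclideanSpace ℝ (Fin m),
    ⟪v, s⟫ = 0 → v ≠ 0 → fderiv ℝ (fun s' => F (s', t)) s v ≠ 0
  leg : ∀ t ∈ Icc (0:ℝ) 1, ∀ s ∈ sph m, ∀ v : EuclideanSpace ℝ (Fin m), ⟪v, s⟫ = 0 →
    (fderiv ℝ (fun s' => F (s', t)) s v).2.2
      = ⟪(F (s, t)).2.1, (fderiv ℝ (fun s' => F (s', t)) s v).1⟫

/-- Non-negativity of the Legendrian isotopy: `∂u/∂t - ⟨p, ∂q/∂t⟩ ≥ 0`. -/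
def NonnegJet (m : ℕ) (F : EuclideanSpace ℝ (Fin m) × ℝ → JetSp m) : Prop :=
  ∀ s ∈ sph m, ∀ t ∈ Icc (0:ℝ) 1,
    0 ≤ deriv (fun t' => (F (s, t')).2.2) t
        - ⟪(F (s, t)).2.1, deriv (fun t' => (F (s, t')).1) t⟫

/-- The gradient of `f` along the sphere (round metric): tangential part of the ambient
gradient; it depends only on `f|_{S^{m-1}}`. -/
def sphGrad (m : ℕ) (f : EuclideanSpace ℝ (Fin m) → ℝ) (q : EuclideanSpace ℝ (Fin m)) :
    EuclideanSpace ℝ (Fin m) :=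
  gradient f q - ⟪gradient f q, q⟫ • q

/-- The 1-jet graph `Λ^f = {(q, ∇f(q), f(q)) : q ∈ S^{m-1}} ⊂ E`. -/
def jetGraph (m : ℕ) (f : EuclideanSpace ℝ (Fin m) → ℝ) : Set (JetSp m) :=
  (fun q => (q, sphGrad m f q, f q)) '' sph m

/-- The slice `Λ_t = F_t(S^{m-1})` of the isotopy. -/
def jetSlice (m : ℕ) (F : EuclideanSpace ℝ (Fin m) × ℝ → JetSp m) (t : ℝ) : Set (JetSp m) :=
  (fun s => F (s, t)) '' sph m

/-! ### A zero of a bounded perturbation of the identity -/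

section Degree

open MeasureTheory

/-- If the functions `t ↦ d x t` are polynomials of bounded degree and the integral of `d · t` is
equal to `c` for small positive `t`, then it is equal to `c` for all `t`. -/
theorem integral_eq_of_polynomial_of_small {α : Type*} [MeasurableSpace α] {μ : Measure α}
    {d : α → ℝ → ℝ} {n : ℕ}
    (hd : ∀ x, ∃ p : Polynomial ℝ, p.natDegree ≤ n ∧ ∀ t, p.eval t = d x t)
    (hd_int : ∀ t, Integrable (fun x => d x t) μ) {c ε : ℝ} (hε : 0 < ε)
    (h : ∀ t ∈ Ioo 0 ε, ∫ x, d x t ∂μ = c) (t : ℝ) : ∫ x, d x t ∂μ = c := by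
  classical
  set s : Finset ℕ := Finset.range (n + 1) with hs
  set v : ℕ → ℝ := fun i => ε * ((i + 1 : ℝ) / (n + 2)) with hv
  have hinj : Set.InjOn v s := by
    intro i _ j _ hij
    have hn : (n + 2 : ℝ) ≠ 0 := by positivity
    simp only [hv] at hij
    field_simp at hij
    have : (i : ℝ) = j := by linarith
    exact_mod_cast this
  have hmem : ∀ i ∈ s, v i ∈ Ioo 0 ε := by
    intro i hi
    have hi' : (i : ℝ) + 1 ≤ n + 1 := by
      have : i + 1 ≤ n + 1 := Finset.mem_range.1 hi
      exact_mod_cast this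
    refine ⟨by simp only [hv]; positivity, ?_⟩
    have : ((i + 1 : ℝ) / (n + 2)) < 1 := by
      rw [div_lt_one (by positivity)]; linarith
    simp only [hv]
    nlinarith
  have hexp : ∀ x, d x t = ∑ i ∈ s, d x (v i) * (Lagrange.basis s v i).eval t := by
    intro x
    obtain ⟨p, hp, hpe⟩ := hd x
    have hdeg : p.degree < (s.card : WithBot ℕ) := by
      refine lt_of_le_of_lt Polynomial.degree_le_natDegree ?_
      simp only [hs, Finset.card_range]
      exact_mod_cast Nat.lt_succ_of_le hp
    have := Lagrange.eq_interpolate hinj hdeg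
    rw [← hpe, this, Lagrange.interpolate_apply, Polynomial.eval_finsetSum]
    refine Finset.sum_congr rfl fun i hi => ?_
    rw [Polynomial.eval_mul, Polynomial.eval_C, hpe]
  simp_rw [hexp]
  rw [integral_finsetSum _ fun i _ => (hd_int (v i)).mul_const _]
  simp_rw [integral_mul_const]
  rw [Finset.sum_congr rfl fun i hi => by rw [h (v i) (hmem i hi)], ← Finset.mul_sum,
    ← Polynomial.eval_finsetSum, Lagrange.sum_basis hinj (by simp [hs])]
  simp

variable {V : Type*} [NormedAddCommGroup V] [InnerProductSpace ℝ V]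

theorem norm_normalize_sub_normalize_le {y z : V} {ε : ℝ} (hε : 0 < ε) (hy : ε ≤ ‖y‖)
    (hz : ε ≤ ‖z‖) : ‖‖y‖⁻¹ • y - ‖z‖⁻¹ • z‖ ≤ 2 / ε * ‖y - z‖ := by
  have hy0 : 0 < ‖y‖ := hε.trans_le hy
  have hz0 : 0 < ‖z‖ := hε.trans_le hz
  have h1 : ‖y‖⁻¹ • y - ‖z‖⁻¹ • z = ‖y‖⁻¹ • (y - z) + (‖y‖⁻¹ - ‖z‖⁻¹) • z := by module
  have h2 : |‖y‖⁻¹ - ‖z‖⁻¹| * ‖z‖ = ‖y‖⁻¹ * |‖z‖ - ‖y‖| := by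
    have : ‖y‖⁻¹ - ‖z‖⁻¹ = ‖y‖⁻¹ * (‖z‖ - ‖y‖) * ‖z‖⁻¹ := by field_simp
    rw [this, abs_mul, abs_mul, abs_of_pos (inv_pos.2 hy0), abs_of_pos (inv_pos.2 hz0)]
    field_simp
  have h3 : |‖z‖ - ‖y‖| ≤ ‖y - z‖ := by
    rw [norm_sub_rev]; exact abs_norm_sub_norm_le z y
  have h4 : ‖y‖⁻¹ ≤ ε⁻¹ := inv_anti₀ hε hy
  calc _ ≤ ‖‖y‖⁻¹ • (y - z)‖ + ‖(‖y‖⁻¹ - ‖z‖⁻¹) • z‖ := h1 ▸ norm_add_le _ _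
    _ = ‖y‖⁻¹ * ‖y - z‖ + ‖y‖⁻¹ * |‖z‖ - ‖y‖| := by
      rw [norm_smul, norm_smul, norm_inv, norm_norm, Real.norm_eq_abs, h2]
    _ ≤ ε⁻¹ * ‖y - z‖ + ε⁻¹ * ‖y - z‖ := by gcongr
    _ = _ := by ring

variable [FiniteDimensional ℝ V]

theorem exists_polynomial_eval_eq_det_one_add_smul (A : V →L[ℝ] V) :
    ∃ p : Polynomial ℝ, p.natDegree ≤ Module.finrank ℝ V ∧
      ∀ t : ℝ, p.eval t = (1 + t • A).det := by
  classical
  set b := Module.finBasis ℝ V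
  set M := LinearMap.toMatrix b b (A : V →ₗ[ℝ] V)
  refine ⟨((Polynomial.X : Polynomial ℝ) • M.map (Polynomial.C : ℝ →+* Polynomial ℝ)
    + (1 : Matrix (Fin (Module.finrank ℝ V)) (Fin (Module.finrank ℝ V)) ℝ).map
      (Polynomial.C : ℝ →+* Polynomial ℝ)).det, ?_, fun t => ?_⟩
  · simpa using Polynomial.natDegree_det_X_add_C_le M 1
  · have : (1 + t • A).det = (1 + t • M).det := by
      have h1 : ((1 + t • A : V →L[ℝ] V) : V →ₗ[ℝ] V) = 1 + t • (A : V →ₗ[ℝ] V) := rfl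
      rw [ContinuousLinearMap.det, h1, ← LinearMap.det_toMatrix b, map_add, map_smul,
        LinearMap.toMatrix_one]
    rw [this, ← Polynomial.coe_evalRingHom, RingHom.map_det]
    congr 1
    ext i j
    by_cases hij : i = j <;> simp [hij] <;> ring

theorem det_one_add_pos_of_norm_lt_one (A : V →L[ℝ] V) (hA : ‖A‖ < 1) : 0 < (1 + A).det := by
  have hne : ∀ s ∈ Icc (0 : ℝ) 1, (1 + s • A).det ≠ 0 := by
    intro s hs h0
    have hs1 : ‖s • A‖ < 1 := by
      rw [norm_smul, Real.norm_eq_abs, abs_of_nonneg hs.1]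
      nlinarith [norm_nonneg A, hs.2]
    have hu : IsUnit (1 + s • A) := by
      have := isUnit_one_sub_of_norm_lt_one (x := -(s • A)) (by simpa using hs1)
      simpa using this
    have h1 := hu.map (ContinuousLinearMap.toLinearMapRingHom : (V →L[ℝ] V) →+* (V →ₗ[ℝ] V))
    have h2 := h1.map (LinearMap.det (M := V) (A := ℝ))
    rw [isUnit_iff_ne_zero] at h2
    exact h2 h0
  have hcont : ContinuousOn (fun s : ℝ => (1 + s • A).det) (Icc 0 1) :=
    (ContinuousLinearMap.continuous_det.comp (by fun_prop)).continuousOn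
  by_contra! hneg
  have : (0 : ℝ) ∈ (fun s : ℝ => (1 + s • A).det) '' Icc 0 1 := by
    refine intermediate_value_Icc' zero_le_one hcont ⟨by simpa using hneg, ?_⟩
    simp [ContinuousLinearMap.det]
  obtain ⟨s, hs, h0⟩ := this
  exact hne s hs h0

/-- There is no Lipschitz `C¹` map from `V` to a sphere which is the radial retraction outside
the corresponding ball. -/
theorem not_exists_retraction {r : V → V} (hr : ContDiff ℝ 1 r) {K : NNReal}
    (hK : LipschitzWith K r) {ρ : ℝ} (hρ : 0 < ρ) (hnorm : ∀ x, ‖r x‖ = ρ)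
    (hout : ∀ x, ρ ≤ ‖x‖ → r x = (ρ / ‖x‖) • x) : False := by
  borelize V
  set μ : Measure V := volume
  have hdiff : Differentiable ℝ r := hr.differentiable one_ne_zero
  set b : V → V := fun x => r x - x with hb
  have hbd : ∀ x, HasFDerivAt b (fderiv ℝ r x - 1) x := fun x =>
    (hdiff x).hasFDerivAt.sub (hasFDerivAt_id x)
  have hbl : LipschitzWith (K + 1) b := hK.sub LipschitzWith.id
  have hcont : Continuous fun x => fderiv ℝ r x - 1 :=
    (hr.continuous_fderiv one_ne_zero).sub continuous_const
  have hnb : ∀ x, ‖fderiv ℝ r x - 1‖ ≤ K + 1 := fun x => by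
    rw [← (hbd x).fderiv]
    simpa using norm_fderiv_le_of_lipschitz ℝ hbl (x₀ := x)
  set d : V → ℝ → ℝ := fun x t => (1 + t • (fderiv ℝ r x - 1)).det with hd
  have hdc : ∀ t, Continuous fun x => d x t := fun t =>
    ContinuousLinearMap.continuous_det.comp (by fun_prop)
  have hd_int : ∀ t, Integrable (fun x => d x t) (μ.restrict (ball 0 ρ)) := fun t =>
    (((hdc t).continuousOn.integrableOn_compact (isCompact_closedBall (0 : V) ρ))).mono_set
      ball_subset_closedBall
  have hsmall : ∀ t ∈ Ioo (0 : ℝ) (1 / (K + 2)),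
      ∫ x in ball 0 ρ, d x t ∂μ = μ.real (ball 0 ρ) := by
    intro t ht
    have hK0 : (0 : ℝ) ≤ K := K.2
    have htK : t * (K + 2) < 1 := by
      have := ht.2
      rwa [lt_div_iff₀ (by positivity)] at this
    have ht1 : t < 1 := by nlinarith [ht.1]
    set g : V → V := fun x => x + t • b x with hg
    have hgd : ∀ x, HasFDerivAt g (1 + t • (fderiv ℝ r x - 1)) x := fun x =>
      (hasFDerivAt_id x).add ((hbd x).const_smul t)
    have hpos : ∀ x, 0 < d x t := fun x => by
      refine det_one_add_pos_of_norm_lt_one _ ?_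
      rw [norm_smul, Real.norm_eq_abs, abs_of_pos ht.1]
      nlinarith [hnb x, ht.1, norm_nonneg (fderiv ℝ r x - 1)]
    obtain ⟨k, hk⟩ : ∃ k : NNReal, (k : ℝ) = t * (K + 1) :=
      ⟨⟨t * (K + 1), by have := ht.1; positivity⟩, rfl⟩
    have hlt : LipschitzWith k fun x => t • b x := by
      refine LipschitzWith.of_dist_le_mul fun x y => ?_
      rw [dist_smul₀, Real.norm_eq_abs, abs_of_pos ht.1, hk, mul_assoc]
      exact mul_le_mul_of_nonneg_left (by simpa using hbl.dist_le_mul x y) ht.1.le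
    have hltt : t * (K + 1) < 1 := by nlinarith [ht.1]
    have hinj : Function.Injective g := by
      intro x y hxy
      have h1 := hlt.dist_le_mul x y
      have h2 : x - y = -(t • b x - t • b y) := by
        have : x + t • b x = y + t • b y := hxy
        rw [neg_sub, sub_eq_sub_iff_add_eq_add, this, add_comm]
      rw [dist_eq_norm, dist_eq_norm, ← norm_neg, ← h2] at h1
      rw [hk] at h1
      have : ‖x - y‖ = 0 := by nlinarith [norm_nonneg (x - y)]
      exact sub_eq_zero.1 (norm_eq_zero.1 this)
    have hsurj : Function.Surjective g := by
      intro y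
      have hc : ContractingWith k fun x => y - t • b x := by
        refine ⟨by rw [← NNReal.coe_lt_coe, hk]; exact_mod_cast hltt, ?_⟩
        have := (LipschitzWith.const y).sub hlt
        simpa using this
      refine ⟨hc.fixedPoint _, ?_⟩
      have := hc.fixedPoint_isFixedPt
      unfold Function.IsFixedPt at this
      simp only [hg]
      nth_rw 1 [← this]
      exact sub_add_cancel _ _
    have himage : g '' ball 0 ρ = ball 0 ρ := by
      apply Subset.antisymm
      · rintro _ ⟨x, hx, rfl⟩
        rw [mem_ball_zero_iff] at hx ⊢
        have : g x = (1 - t) • x + t • r x := by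
          simp only [hg, hb]; module
        rw [this]
        calc _ ≤ ‖(1 - t) • x‖ + ‖t • r x‖ := norm_add_le _ _
          _ = (1 - t) * ‖x‖ + t * ρ := by
            rw [norm_smul, norm_smul, hnorm, Real.norm_eq_abs, Real.norm_eq_abs,
              abs_of_pos ht.1, abs_of_pos (by linarith)]
          _ < ρ := by nlinarith
      · intro y hy
        obtain ⟨x, rfl⟩ := hsurj y
        refine ⟨x, ?_, rfl⟩
        by_contra hx
        rw [mem_ball_zero_iff, not_lt] at hx
        rw [mem_ball_zero_iff] at hy
        have hx0 : 0 < ‖x‖ := hρ.trans_le hx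
        have : g x = (1 - t + t * (ρ / ‖x‖)) • x := by
          simp only [hg, hb, hout x hx]; module
        have hq : 0 ≤ 1 - t + t * (ρ / ‖x‖) := by
          have := ht.1
          have : 0 ≤ 1 - t := by linarith
          positivity
        rw [this, norm_smul, Real.norm_eq_abs, abs_of_nonneg hq] at hy
        have : (1 - t + t * (ρ / ‖x‖)) * ‖x‖ = (1 - t) * ‖x‖ + t * ρ := by
          field_simp
        nlinarith
    have key := integral_image_eq_integral_abs_det_fderiv_smul μ measurableSet_ball
      (fun x _ => (hgd x).hasFDerivWithinAt) hinj.injOn (fun _ : V => (1 : ℝ)) (s := ball 0 ρ)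
    rw [himage] at key
    simp only [smul_eq_mul, mul_one, integral_const, measureReal_restrict_apply_univ] at key
    rw [key]
    refine integral_congr_ae (Filter.Eventually.of_forall fun x => ?_)
    exact (abs_of_pos (hpos x)).symm
  have hone := integral_eq_of_polynomial_of_small
    (fun x => exists_polynomial_eval_eq_det_one_add_smul (fderiv ℝ r x - 1)) hd_int
    (by positivity) hsmall 1
  have hzero : ∀ x, (1 + (1 : ℝ) • (fderiv ℝ r x - 1)).det = 0 := by
    intro x
    have h1 : 1 + (1 : ℝ) • (fderiv ℝ r x - 1) = fderiv ℝ r x := by simp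
    rw [h1]
    by_contra hne
    obtain ⟨v, hv⟩ := (LinearMap.equivOfDetNeZero _ hne).surjective (r x)
    have hv' : fderiv ℝ r x v = r x := hv
    have hsq : HasFDerivAt (fun y => ⟪r y, r y⟫) (0 : V →L[ℝ] ℝ) x := by
      have : (fun y => ⟪r y, r y⟫) = fun _ => ρ ^ 2 := by
        ext y; rw [real_inner_self_eq_norm_sq, hnorm]
      rw [this]; exact hasFDerivAt_const _ _
    have h2 := ((hdiff x).hasFDerivAt.inner ℝ (hdiff x).hasFDerivAt).unique hsq
    have h3 := congrArg (fun L => L v) h2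
    simp [hv', hnorm] at h3
    exact hρ.ne' h3
  rw [integral_congr_ae (Filter.Eventually.of_forall hzero)] at hone
  simp only [integral_zero] at hone
  have hpos : 0 < μ.real (ball (0 : V) ρ) :=
    ENNReal.toReal_pos (measure_ball_pos μ 0 hρ).ne' measure_ball_lt_top.ne
  exact hpos.ne hone

/-- A `C¹` map at bounded distance from the identity has a zero. -/
theorem exists_eq_zero_of_norm_sub_le {g : V → V} (hg : ContDiff ℝ 1 g) {M : ℝ}
    (hM : ∀ x, ‖g x - x‖ ≤ M) : ∃ x, g x = 0 := by
  by_contra! hne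
  have hM0 : 0 ≤ M := (norm_nonneg _).trans (hM 0)
  let χ : ContDiffBump (0 : V) := ⟨M + 1, M + 2, by linarith, by linarith⟩
  set b : V → V := fun x => χ x • (g x - x) with hb
  set G : V → V := fun x => x + b x with hG
  have hbc : ContDiff ℝ 1 b := χ.contDiff.smul (hg.sub contDiff_id)
  have hGc : ContDiff ℝ 1 G := contDiff_id.add hbc
  have hbs : HasCompactSupport b := χ.hasCompactSupport.smul_right
  obtain ⟨K, hK⟩ := hbc.lipschitzWith_of_hasCompactSupport hbs one_ne_zero
  have hGK : LipschitzWith (1 + K) G := LipschitzWith.id.add hK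
  have hbM : ∀ x, ‖b x‖ ≤ M := fun x => by
    rw [hb, norm_smul, Real.norm_eq_abs, abs_of_nonneg χ.nonneg]
    calc _ ≤ 1 * M := mul_le_mul χ.le_one (hM x) (norm_nonneg _) zero_le_one
      _ = M := one_mul M
  have hout : ∀ x, M + 2 ≤ ‖x‖ → G x = x := fun x hx => by
    have : χ x = 0 := χ.zero_of_le_dist (by simpa [χ] using hx)
    simp [hG, hb, this]
  have hG0 : ∀ x, G x ≠ 0 := by
    intro x hx
    rcases le_or_gt ‖x‖ (M + 1) with h | h
    · have : χ x = 1 := χ.one_of_mem_closedBall (by simpa [χ] using h)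
      simp [hG, hb, this] at hx
      exact hne x hx
    · have h1 : x = -b x := eq_neg_of_add_eq_zero_left hx
      have h2 : ‖x‖ ≤ M := by rw [h1, norm_neg]; exact hbM x
      linarith
  obtain ⟨ε, hε, hεG⟩ : ∃ ε > 0, ∀ x, ε ≤ ‖G x‖ := by
    obtain ⟨x₀, -, hx₀⟩ := (isCompact_closedBall (0 : V) (M + 2)).exists_isMinOn
      ⟨0, by simp; linarith⟩ hGc.continuous.norm.continuousOn
    refine ⟨min ‖G x₀‖ (M + 2), lt_min (norm_pos_iff.2 (hG0 x₀)) (by linarith), fun x => ?_⟩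
    rcases le_or_gt ‖x‖ (M + 2) with h | h
    · exact (min_le_left _ _).trans (hx₀ (by simpa using h))
    · rw [hout x h.le]
      exact (min_le_right _ _).trans h.le
  have hr : ContDiff ℝ 1 fun x => (M + 2) • (‖G x‖⁻¹ • G x) :=
    (((hGc.norm ℝ hG0).inv fun x => norm_ne_zero_iff.2 (hG0 x)).smul hGc).const_smul _
  have hrl : LipschitzWith ((M + 2).toNNReal * ((2 / ε).toNNReal * (1 + K)))
      fun x => (M + 2) • (‖G x‖⁻¹ • G x) := by
    refine LipschitzWith.of_dist_le_mul fun x y => ?_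
    have h2 : (0 : ℝ) ≤ 2 / ε := by positivity
    rw [dist_smul₀, Real.norm_eq_abs, abs_of_pos (by linarith), NNReal.coe_mul, NNReal.coe_mul,
      Real.coe_toNNReal _ (by linarith), Real.coe_toNNReal _ h2, mul_assoc, mul_assoc]
    refine mul_le_mul_of_nonneg_left ?_ (by linarith)
    rw [dist_eq_norm]
    refine (norm_normalize_sub_normalize_le hε (hεG x) (hεG y)).trans ?_
    refine mul_le_mul_of_nonneg_left ?_ h2
    rw [← dist_eq_norm]
    exact hGK.dist_le_mul x y
  refine not_exists_retraction hr hrl (by linarith : 0 < M + 2) (fun x => ?_) fun x hx => ?_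
  · have := norm_pos_iff.2 (hG0 x)
    rw [norm_smul, norm_smul, norm_inv, norm_norm, inv_mul_cancel₀ this.ne', mul_one,
      Real.norm_eq_abs, abs_of_pos (by linarith)]
  · simp only [hout x hx]
    rw [smul_smul, div_eq_mul_inv]

end Degree

/-! ### Critical points of bounded perturbations of a hyperbolic quadratic form -/

section Minimax

theorem abs_sub_sub_fderiv_le_of_lipschitzWith {E : Type*} [NormedAddCommGroup E]
    [NormedSpace ℝ E] {B : E → ℝ} (hB : Differentiable ℝ B) {L : NNReal}
    (hL : LipschitzWith L (fderiv ℝ B)) (x v : E) :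
    |B (x + v) - B x - fderiv ℝ B x v| ≤ L * ‖v‖ ^ 2 := by
  have h : ∀ y ∈ closedBall x ‖v‖, ‖fderiv ℝ B y - fderiv ℝ B x‖ ≤ L * ‖v‖ := fun y hy => by
    rw [← dist_eq_norm]
    exact (hL.dist_le_mul y x).trans (mul_le_mul_of_nonneg_left (mem_closedBall.1 hy) L.2)
  have := (convex_closedBall x ‖v‖).norm_image_sub_le_of_norm_fderiv_le' (𝕜 := ℝ)
    (fun y _ => hB y) h (mem_closedBall_self (norm_nonneg v)) (y := x + v) (by simp)
  simpa [pow_two, mul_assoc] using this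

variable {V : Type*} [NormedAddCommGroup V] [InnerProductSpace ℝ V] [FiniteDimensional ℝ V]

/-- The gradient of `(Z, P) ↦ ⟪P, Z⟫ + B (Z, P)`. -/
def hypGrad (B : V × V → ℝ) (x : V × V) : V × V :=
  (x.2 + (InnerProductSpace.toDual ℝ V).symm ((fderiv ℝ B x).comp (.inl ℝ V V)),
    x.1 + (InnerProductSpace.toDual ℝ V).symm ((fderiv ℝ B x).comp (.inr ℝ V V)))

theorem inner_hypGrad (B : V × V → ℝ) (x v : V × V) :
    ⟪(hypGrad B x).1, v.1⟫ + ⟪(hypGrad B x).2, v.2⟫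
      = ⟪x.2, v.1⟫ + ⟪x.1, v.2⟫ + fderiv ℝ B x v := by
  have : fderiv ℝ B x v = fderiv ℝ B x (v.1, 0) + fderiv ℝ B x (0, v.2) := by
    rw [← map_add]; simp
  rw [this]
  simp only [hypGrad, inner_add_left, InnerProductSpace.toDual_symm_apply,
    ContinuousLinearMap.comp_apply, ContinuousLinearMap.inl_apply, ContinuousLinearMap.inr_apply]
  ring

theorem norm_hypGrad_sub_le {B : V × V → ℝ} {M : ℝ} (hM : ∀ x, ‖fderiv ℝ B x‖ ≤ M) (x : V × V) :
    ‖(hypGrad B x).1 - x.2‖ ≤ M ∧ ‖(hypGrad B x).2 - x.1‖ ≤ M := by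
  have hM0 : 0 ≤ M := le_trans (norm_nonneg (fderiv ℝ B x)) (hM x)
  constructor
  · simp only [hypGrad, add_sub_cancel_left, LinearIsometryEquiv.norm_map]
    refine (ContinuousLinearMap.opNorm_comp_le _ _).trans ?_
    exact (mul_le_mul (hM x) (ContinuousLinearMap.norm_inl_le_one ℝ V V) (by positivity)
      hM0).trans_eq (mul_one M)
  · simp only [hypGrad, add_sub_cancel_left, LinearIsometryEquiv.norm_map]
    refine (ContinuousLinearMap.opNorm_comp_le _ _).trans ?_
    exact (mul_le_mul (hM x) (ContinuousLinearMap.norm_inr_le_one ℝ V V) (by positivity)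
      hM0).trans_eq (mul_one M)

theorem contDiff_hypGrad {B : V × V → ℝ} (hB : ContDiff ℝ 2 B) : ContDiff ℝ 1 (hypGrad B) := by
  have h : ContDiff ℝ 1 (fderiv ℝ B) := hB.fderiv_right (by norm_num)
  have hJ : ContDiff ℝ 1 (InnerProductSpace.toDual ℝ V).symm :=
    (InnerProductSpace.toDual ℝ V).symm.toContinuousLinearEquiv.contDiff
  exact (contDiff_snd.add (hJ.comp (h.clm_comp contDiff_const))).prodMk
    (contDiff_fst.add (hJ.comp (h.clm_comp contDiff_const)))

/-- A bounded `C²` perturbation of the quadratic form `⟪P, Z⟫`, with bounded Lipschitz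
derivative, which is at least `c` on `{Z = 0}` has a critical value which is at least `c`. -/
theorem exists_critical_point_of_le {B : V × V → ℝ} (hB : ContDiff ℝ 2 B) {M₀ M₁ : ℝ}
    {L : NNReal} (hM₀ : ∀ x, |B x| ≤ M₀) (hM₁ : ∀ x, ‖fderiv ℝ B x‖ ≤ M₁)
    (hL : LipschitzWith L (fderiv ℝ B)) {c : ℝ} (hc : ∀ P, c ≤ B (0, P)) :
    ∃ x : V × V, (∀ v : V × V, ⟪x.2, v.1⟫ + ⟪x.1, v.2⟫ + fderiv ℝ B x v = 0) ∧
      c ≤ ⟪x.2, x.1⟫ + B x := by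
  set S : V × V → ℝ := fun x => ⟪x.2, x.1⟫ + B x with hS
  set X := hypGrad B with hX
  have hXc : ContDiff ℝ 1 X := contDiff_hypGrad hB
  have hSc : Continuous S := by
    have := hB.continuous
    fun_prop
  by_contra! hcrit
  have hXne : ∀ x, c ≤ S x → X x ≠ 0 := by
    intro x hx h0
    refine absurd hx (not_le.2 (hcrit x fun v => ?_))
    rw [← inner_hypGrad, ← hX, h0]
    simp
  obtain ⟨μ, hμ, hμX⟩ : ∃ μ > 0, ∀ x, c ≤ S x → μ ≤ ‖X x‖ := by
    have hcompact : IsCompact (closedBall (0 : V × V) (M₁ + 1) ∩ {x | c ≤ S x}) :=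
      (isCompact_closedBall _ _).inter_right (isClosed_le continuous_const hSc)
    have hfar : ∀ x, M₁ + 1 < ‖x‖ → 1 ≤ ‖X x‖ := by
      intro x hx
      obtain ⟨h1, h2⟩ := norm_hypGrad_sub_le hM₁ x
      rw [Prod.norm_def, lt_max_iff] at hx
      rw [Prod.norm_def, le_max_iff]
      rcases hx with hx | hx
      · right
        have := norm_sub_norm_le x.1 (X x).2
        rw [norm_sub_rev] at this
        linarith
      · left
        have := norm_sub_norm_le x.2 (X x).1
        rw [norm_sub_rev] at this
        linarith
    rcases (closedBall (0 : V × V) (M₁ + 1) ∩ {x | c ≤ S x}).eq_empty_or_nonempty with he | hne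
    · refine ⟨1, one_pos, fun x hx => hfar x ?_⟩
      by_contra! h
      exact notMem_empty x (he ▸ ⟨by simpa using h, hx⟩)
    · obtain ⟨x₀, hx₀, hmin⟩ := hcompact.exists_isMinOn hne hXc.continuous.norm.continuousOn
      refine ⟨min ‖X x₀‖ 1, lt_min (norm_pos_iff.2 (hXne x₀ hx₀.2)) one_pos, fun x hx => ?_⟩
      rcases le_or_gt ‖x‖ (M₁ + 1) with h | h
      · exact (min_le_left _ _).trans (hmin ⟨by simpa using h, hx⟩)
      · exact (min_le_right _ _).trans (hfar x h)
  set δ : ℝ := 1 / (2 * (1 + L)) with hδ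
  have hL0 : (0 : ℝ) ≤ L := L.2
  have hδ0 : 0 < δ := by positivity
  have hδL : δ * (1 + L) = 1 / 2 := by rw [hδ]; field_simp
  set T : V × V → V × V := fun x => x + δ • X x with hT
  have hTc : ContDiff ℝ 1 T := contDiff_id.add (hXc.const_smul δ)
  have hgain : ∀ x, S x + δ / 2 * ‖X x‖ ^ 2 ≤ S (T x) := by
    intro x
    have h1 := (abs_le.1 (abs_sub_sub_fderiv_le_of_lipschitzWith
      (hB.differentiable two_ne_zero) hL x (δ • X x))).1
    have h2 := inner_hypGrad B x (X x)
    rw [← hX, real_inner_self_eq_norm_sq, real_inner_self_eq_norm_sq] at h2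
    have h3 : S (T x) = ⟪x.2, x.1⟫ + δ * (⟪x.2, (X x).1⟫ + ⟪x.1, (X x).2⟫)
        + δ ^ 2 * ⟪(X x).2, (X x).1⟫ + B (x + δ • X x) := by
      simp only [hS, hT, Prod.fst_add, Prod.snd_add, Prod.smul_fst, Prod.smul_snd,
        inner_add_left, inner_add_right, inner_smul_left, inner_smul_right]
      rw [real_inner_comm x.1 (X x).2]
      simp
      ring
    have h4 : -(‖(X x).2‖ * ‖(X x).1‖) ≤ ⟪(X x).2, (X x).1⟫ :=
      (abs_le.1 (abs_real_inner_le_norm _ _)).1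
    have h5 : ‖X x‖ ^ 2 ≤ ‖(X x).1‖ ^ 2 + ‖(X x).2‖ ^ 2 := by
      rw [Prod.norm_def]
      rcases max_choice ‖(X x).1‖ ‖(X x).2‖ with h | h <;> rw [h] <;>
        nlinarith [sq_nonneg ‖(X x).1‖, sq_nonneg ‖(X x).2‖]
    rw [map_smul, norm_smul, Real.norm_eq_abs, abs_of_pos hδ0, smul_eq_mul, mul_pow] at h1
    set N := ‖(X x).1‖ ^ 2 + ‖(X x).2‖ ^ 2 with hN
    have h6 : ‖(X x).2‖ * ‖(X x).1‖ ≤ N := by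
      nlinarith [sq_nonneg (‖(X x).1‖ - ‖(X x).2‖), sq_nonneg ‖(X x).1‖, sq_nonneg ‖(X x).2‖]
    have h7 : δ ^ 2 * ⟪(X x).2, (X x).1⟫ ≥ -(δ ^ 2 * N) := by
      nlinarith [sq_nonneg δ]
    have h8 : (L : ℝ) * (δ ^ 2 * ‖X x‖ ^ 2) ≤ L * (δ ^ 2 * N) := by gcongr
    have h9 : δ / 2 * ‖X x‖ ^ 2 ≤ δ / 2 * N := by gcongr
    have h10 : δ ^ 2 * N + L * (δ ^ 2 * N) = δ / 2 * N := by
      calc _ = δ * (δ * (1 + L)) * N := by ring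
        _ = _ := by rw [hδL]; ring
    rw [h3]
    simp only [hS]
    have h11 : δ * (⟪x.2, (X x).1⟫ + ⟪x.1, (X x).2⟫) + δ * fderiv ℝ B x (X x) = δ * N := by
      rw [h2]; ring
    linarith
  have hiter : ∀ k : ℕ, ∀ P, c + k * (δ / 2 * μ ^ 2) ≤ S (T^[k] (0, P)) := by
    intro k P
    induction k with
    | zero => simpa [hS] using hc P
    | succ k ih =>
      rw [Function.iterate_succ_apply']
      have h1 : c ≤ S (T^[k] (0, P)) := le_trans (by
        have : 0 ≤ (k : ℝ) * (δ / 2 * μ ^ 2) := by positivity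
        linarith) ih
      have h2 : δ / 2 * μ ^ 2 ≤ δ / 2 * ‖X (T^[k] (0, P))‖ ^ 2 := by
        have := hμX _ h1
        gcongr
      have := hgain (T^[k] (0, P))
      push_cast
      linarith
  have hbdd : ∀ k : ℕ, ∃ C, ∀ P : V,
      ‖((T^[k] (0, P)).1 + (T^[k] (0, P)).2) - (1 + δ) ^ k • P‖ ≤ C := by
    intro k
    induction k with
    | zero => exact ⟨0, fun P => by simp⟩
    | succ k ih =>
      obtain ⟨C, hC⟩ := ih
      refine ⟨(1 + δ) * C + δ * (M₁ + M₁), fun P => ?_⟩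
      rw [Function.iterate_succ_apply']
      set y := T^[k] (0, P)
      obtain ⟨h1, h2⟩ := norm_hypGrad_sub_le hM₁ y
      have h3 : (T y).1 + (T y).2 - (1 + δ) ^ (k + 1) • P = (1 + δ) • (y.1 + y.2 - (1 + δ) ^ k • P)
          + δ • (((X y).1 - y.2) + ((X y).2 - y.1)) := by
        simp only [hT, Prod.fst_add, Prod.snd_add, Prod.smul_fst, Prod.smul_snd, pow_succ]
        module
      rw [h3]
      refine (norm_add_le _ _).trans (add_le_add ?_ ?_)
      · rw [norm_smul, Real.norm_eq_abs, abs_of_pos (by linarith)]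
        exact mul_le_mul_of_nonneg_left (hC P) (by linarith)
      · rw [norm_smul, Real.norm_eq_abs, abs_of_pos hδ0]
        exact mul_le_mul_of_nonneg_left ((norm_add_le _ _).trans (add_le_add h1 h2)) hδ0.le
  obtain ⟨k, hk⟩ := exists_nat_gt ((M₀ - c) / (δ / 2 * μ ^ 2))
  rw [div_lt_iff₀ (by positivity)] at hk
  obtain ⟨C, hC⟩ := hbdd k
  have hpow : 0 < (1 + δ) ^ k := by positivity
  have hiterc : ∀ k : ℕ, ContDiff ℝ 1 T^[k] := by
    intro k
    induction k with
    | zero => exact contDiff_id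
    | succ k ih => exact ih.comp hTc
  obtain ⟨P, hP⟩ := exists_eq_zero_of_norm_sub_le
    (g := fun P => ((1 + δ) ^ k)⁻¹ • ((T^[k] (0, P)).1 + (T^[k] (0, P)).2))
    (M := ((1 + δ) ^ k)⁻¹ * C)
    (by
      have : ContDiff ℝ 1 fun P : V => T^[k] (0, P) :=
        (hiterc k).comp (contDiff_const.prodMk contDiff_id)
      exact (this.fst.add this.snd).const_smul _)
    (fun P => by
      have : ((1 + δ) ^ k)⁻¹ • ((T^[k] (0, P)).1 + (T^[k] (0, P)).2) - P
          = ((1 + δ) ^ k)⁻¹ • (((T^[k] (0, P)).1 + (T^[k] (0, P)).2) - (1 + δ) ^ k • P) := by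
        rw [smul_sub, inv_smul_smul₀ hpow.ne']
      rw [this, norm_smul, norm_inv, Real.norm_eq_abs, abs_of_pos hpow]
      exact mul_le_mul_of_nonneg_left (hC P) (by positivity))
  have h0 := (smul_eq_zero.1 hP).resolve_left (inv_ne_zero hpow.ne')
  have h1 := hiter k P
  set y := T^[k] (0, P)
  have h2 : S y ≤ M₀ := by
    have h3 : y.2 = -y.1 := eq_neg_of_add_eq_zero_right h0
    have h4 := (abs_le.1 (hM₀ y)).2
    simp only [hS]
    rw [h3, inner_neg_left, real_inner_self_eq_norm_sq]
    nlinarith [sq_nonneg ‖y.1‖]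
  linarith

end Minimax

/-! ### The discretized action functional -/

section Discretization

section Tame

variable {X Y : Type*} [NormedAddCommGroup X] [NormedSpace ℝ X]
  [NormedAddCommGroup Y] [NormedSpace ℝ Y]

/-- A `C²` function which is bounded and whose derivative is bounded and Lipschitz. -/
structure IsTame (f : X → ℝ) : Prop where
  contDiff : ContDiff ℝ 2 f
  bounded : ∃ M, ∀ x, |f x| ≤ M
  bounded_fderiv : ∃ M, ∀ x, ‖fderiv ℝ f x‖ ≤ M
  lipschitz : ∃ L, LipschitzWith L (fderiv ℝ f)

theorem IsTame.differentiable {f : X → ℝ} (hf : IsTame f) : Differentiable ℝ f :=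
  hf.contDiff.differentiable two_ne_zero

theorem IsTame.of_hasCompactSupport {f : X → ℝ} (hf : ContDiff ℝ 2 f)
    (hc : HasCompactSupport f) : IsTame f := by
  have h1 : ContDiff ℝ 1 (fderiv ℝ f) := hf.fderiv_right (by norm_num)
  refine ⟨hf, ?_, ?_, h1.lipschitzWith_of_hasCompactSupport (hc.fderiv ℝ) one_ne_zero⟩
  · exact hc.exists_bound_of_continuous hf.continuous
  · exact (hc.fderiv ℝ).exists_bound_of_continuous h1.continuous

theorem IsTame.zero : IsTame (fun _ : X => (0 : ℝ)) :=
  ⟨contDiff_const, ⟨0, by simp⟩, ⟨0, by simp⟩, ⟨0, by simp⟩⟩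

theorem IsTame.add {f g : X → ℝ} (hf : IsTame f) (hg : IsTame g) :
    IsTame (fun x => f x + g x) := by
  have h : fderiv ℝ (fun x => f x + g x) = fun x => fderiv ℝ f x + fderiv ℝ g x :=
    funext fun x => fderiv_fun_add (hf.differentiable x) (hg.differentiable x)
  obtain ⟨M, hM⟩ := hf.bounded
  obtain ⟨M', hM'⟩ := hg.bounded
  obtain ⟨D, hD⟩ := hf.bounded_fderiv
  obtain ⟨D', hD'⟩ := hg.bounded_fderiv
  obtain ⟨L, hL⟩ := hf.lipschitz
  obtain ⟨L', hL'⟩ := hg.lipschitz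
  refine ⟨hf.contDiff.add hg.contDiff, ⟨M + M', fun x => ?_⟩, ⟨D + D', fun x => ?_⟩,
    ⟨L + L', ?_⟩⟩
  · exact (abs_add_le _ _).trans (add_le_add (hM x) (hM' x))
  · rw [h]
    exact (norm_add_le _ _).trans (add_le_add (hD x) (hD' x))
  · rw [h]
    exact hL.add hL'

theorem IsTame.const_mul {f : X → ℝ} (hf : IsTame f) (a : ℝ) : IsTame (fun x => a * f x) := by
  have h : fderiv ℝ (fun x => a * f x) = fun x => a • fderiv ℝ f x :=
    funext fun x => fderiv_const_mul (hf.differentiable x) a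
  obtain ⟨M, hM⟩ := hf.bounded
  obtain ⟨D, hD⟩ := hf.bounded_fderiv
  obtain ⟨L, hL⟩ := hf.lipschitz
  refine ⟨contDiff_const.mul hf.contDiff, ⟨|a| * M, fun x => ?_⟩, ⟨|a| * D, fun x => ?_⟩,
    ⟨‖a‖₊ * L, ?_⟩⟩
  · rw [abs_mul]
    exact mul_le_mul_of_nonneg_left (hM x) (abs_nonneg a)
  · rw [h, norm_smul, Real.norm_eq_abs]
    exact mul_le_mul_of_nonneg_left (hD x) (abs_nonneg a)
  · rw [h]
    exact (lipschitzWith_smul a).comp hL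

theorem IsTame.sum {ι : Type*} (s : Finset ι) {f : ι → X → ℝ} (hf : ∀ i ∈ s, IsTame (f i)) :
    IsTame (fun x => ∑ i ∈ s, f i x) := by
  classical
  induction s using Finset.induction_on with
  | empty => simpa using IsTame.zero
  | insert i s hi ih =>
    simp only [Finset.sum_insert hi]
    exact (hf i (by simp)).add (ih fun j hj => hf j (by simp [hj]))

theorem IsTame.comp_affine {f : Y → ℝ} (hf : IsTame f) (y : Y) (A : X →L[ℝ] Y) :
    IsTame (fun x => f (y + A x)) := by
  have hA : ∀ x, HasFDerivAt (fun x => y + A x) A x := fun x => A.hasFDerivAt.const_add y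
  have h : fderiv ℝ (fun x => f (y + A x)) = fun x => (fderiv ℝ f (y + A x)).comp A :=
    funext fun x => ((hf.differentiable _).hasFDerivAt.comp x (hA x)).fderiv
  obtain ⟨M, hM⟩ := hf.bounded
  obtain ⟨D, hD⟩ := hf.bounded_fderiv
  obtain ⟨L, hL⟩ := hf.lipschitz
  refine ⟨hf.contDiff.comp (contDiff_const.add A.contDiff), ⟨M, fun x => hM _⟩,
    ⟨D * ‖A‖, fun x => ?_⟩, ⟨L * ‖A‖₊ * ‖A‖₊, LipschitzWith.of_dist_le_mul fun x x' => ?_⟩⟩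
  · rw [h]
    exact (ContinuousLinearMap.opNorm_comp_le _ _).trans
      (mul_le_mul_of_nonneg_right (hD _) (by positivity))
  · rw [h, dist_eq_norm, ← ContinuousLinearMap.sub_comp]
    refine (ContinuousLinearMap.opNorm_comp_le _ _).trans ?_
    have h1 : ‖fderiv ℝ f (y + A x) - fderiv ℝ f (y + A x')‖ ≤ L * (‖A‖ * ‖x - x'‖) := by
      rw [← dist_eq_norm]
      refine (hL.dist_le_mul _ _).trans (mul_le_mul_of_nonneg_left ?_ L.2)
      rw [dist_add_left, dist_eq_norm, ← map_sub]
      exact A.le_opNorm _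
    refine (mul_le_mul_of_nonneg_right h1 (by positivity)).trans_eq ?_
    rw [dist_eq_norm]
    push_cast
    ring

end Tame

variable {E : Type*} [NormedAddCommGroup E] [InnerProductSpace ℝ E]

/-- The space of `N`-tuples of vectors of `E`, with its Euclidean structure. -/
abbrev PathSpace (E : Type*) (N : ℕ) := PiLp 2 (fun _ : Fin N => E)

/-- The sum of the entries of index at least `j`. -/
def tailSum (E : Type*) [NormedAddCommGroup E] [InnerProductSpace ℝ E] (N j : ℕ) :
    PathSpace E N →L[ℝ] E :=
  ∑ i ∈ Finset.univ.filter (fun i : Fin N => j ≤ i), PiLp.proj 2 (fun _ : Fin N => E) i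

theorem tailSum_single {N : ℕ} (j : ℕ) (i : Fin N) (w : E) :
    tailSum E N j (PiLp.single 2 i w) = if j ≤ i then w else 0 := by
  simp [tailSum]

theorem tailSum_sub_succ {N j : ℕ} (hj : j < N) (Z : PathSpace E N) :
    tailSum E N j Z - tailSum E N (j + 1) Z = Z ⟨j, hj⟩ := by
  have : Finset.univ.filter (fun i : Fin N => j ≤ i)
      = insert ⟨j, hj⟩ (Finset.univ.filter (fun i : Fin N => j + 1 ≤ i)) := by
    ext i
    simp [Fin.ext_iff]
    omega
  rw [tailSum, tailSum, this, Finset.sum_insert (by simp)]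
  simp

theorem tailSum_self (N : ℕ) : tailSum E N N = 0 := by
  have : Finset.univ.filter (fun i : Fin N => N ≤ i) = ∅ := by
    ext i
    simp
  simp [tailSum, this]

theorem inner_pathSpace_single {N : ℕ} (Z : PathSpace E N) (i : Fin N) (w : E) :
    ⟪Z, (PiLp.single 2 i w : PathSpace E N)⟫ = ⟪Z i, w⟫ := by
  rw [PiLp.inner_apply, Finset.sum_eq_single i]
  · simp
  · intro j _ hj
    simp [hj]
  · simp

variable [FiniteDimensional ℝ E]

/-- The time-dependent Hamiltonian vector field `(-∂K/∂P, ∂K/∂Y)` of `K (Y, P, t)`. -/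
def hamVF (K : E × E × ℝ → ℝ) (x : E × E × ℝ) : E × E :=
  (-(InnerProductSpace.toDual ℝ E).symm
      ((fderiv ℝ K x).comp ((ContinuousLinearMap.inr ℝ E (E × ℝ)).comp (.inl ℝ E ℝ))),
    (InnerProductSpace.toDual ℝ E).symm ((fderiv ℝ K x).comp (.inl ℝ E (E × ℝ))))

theorem inner_hamVF_fst (K : E × E × ℝ → ℝ) (x : E × E × ℝ) (w : E) :
    ⟪(hamVF K x).1, w⟫ = -fderiv ℝ K x (0, w, 0) := by
  simp [hamVF, inner_neg_left]

theorem inner_hamVF_snd (K : E × E × ℝ → ℝ) (x : E × E × ℝ) (w : E) :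
    ⟪(hamVF K x).2, w⟫ = fderiv ℝ K x (w, 0, 0) := by
  simp only [hamVF, InnerProductSpace.toDual_symm_apply]
  rfl

theorem contDiff_hamVF {K : E × E × ℝ → ℝ} (hK : ContDiff ℝ 2 K) : ContDiff ℝ 1 (hamVF K) := by
  have h : ContDiff ℝ 1 (fderiv ℝ K) := hK.fderiv_right (by norm_num)
  have hJ : ContDiff ℝ 1 (InnerProductSpace.toDual ℝ E).symm :=
    (InnerProductSpace.toDual ℝ E).symm.toContinuousLinearEquiv.contDiff
  exact (hJ.comp (h.clm_comp contDiff_const)).neg.prodMk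
    (hJ.comp (h.clm_comp contDiff_const))

theorem hasCompactSupport_hamVF {K : E × E × ℝ → ℝ} (hK : HasCompactSupport K) :
    HasCompactSupport (hamVF K) := by
  refine (hK.fderiv ℝ).mono fun x hx h0 => hx ?_
  simp [hamVF, h0]

/-- Discrete Hamiltonian trajectories from the graph of `∇g` to the fibre over `q₀`, with
action at least `g q₀` when `K` is non-negative. -/
theorem exists_discrete_trajectory {K : E × E × ℝ → ℝ} (hK : ContDiff ℝ 2 K)
    (hKc : HasCompactSupport K) (hK0 : ∀ x, 0 ≤ K x) {g : E → ℝ} (hg : ContDiff ℝ 2 g)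
    (hgc : HasCompactSupport g) (q₀ : E) (N : ℕ) :
    ∃ z : ℕ → E × E, (z N).1 = q₀ ∧ (z 0).2 = gradient g (z 0).1 ∧
      (∀ j < N, z (j + 1) = z j + (N : ℝ)⁻¹ • hamVF K ((z (j + 1)).1, (z j).2, j / N)) ∧
      g q₀ ≤ g (z 0).1 + ∑ j ∈ Finset.range N, (⟪(z j).2, (z (j + 1)).1 - (z j).1⟫
        + (N : ℝ)⁻¹ * K ((z (j + 1)).1, (z j).2, j / N)) := by
  classical
  let A : Fin N → PathSpace E N × PathSpace E N →L[ℝ] E × E × ℝ := fun j =>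
    (-(tailSum E N (j + 1)).comp (.fst ℝ (PathSpace E N) (PathSpace E N))).prod
      (((PiLp.proj 2 (fun _ : Fin N => E) j).comp (.snd ℝ (PathSpace E N) (PathSpace E N))).prod 0)
  let A₀ : PathSpace E N × PathSpace E N →L[ℝ] E :=
    -(tailSum E N 0).comp (.fst ℝ (PathSpace E N) (PathSpace E N))
  let B : PathSpace E N × PathSpace E N → ℝ := fun x => g (q₀ + A₀ x)
    + (N : ℝ)⁻¹ * ∑ j : Fin N, K ((q₀, 0, ((j : ℕ) : ℝ) / N) + A j x)
  have hB : IsTame B := ((IsTame.of_hasCompactSupport hg hgc).comp_affine q₀ A₀).add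
    ((IsTame.sum Finset.univ fun (j : Fin N) _ =>
      (IsTame.of_hasCompactSupport hK hKc).comp_affine (q₀, 0, ((j : ℕ) : ℝ) / N)
        (A j)).const_mul _)
  have hBd : ∀ x v, fderiv ℝ B x v = fderiv ℝ g (q₀ + A₀ x) (A₀ v)
      + (N : ℝ)⁻¹ * ∑ j : Fin N, fderiv ℝ K ((q₀, 0, ((j : ℕ) : ℝ) / N) + A j x) (A j v) := by
    intro x v
    have h1 : HasFDerivAt B (((fderiv ℝ g (q₀ + A₀ x)).comp A₀)
      + (N : ℝ)⁻¹ • ∑ j : Fin N, (fderiv ℝ K ((q₀, 0, ((j : ℕ) : ℝ) / N) + A j x)).comp (A j))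
        x := by
      refine HasFDerivAt.add ?_ (HasFDerivAt.const_mul (HasFDerivAt.fun_sum fun j _ => ?_) _)
      · exact HasFDerivAt.comp x (hg.differentiable two_ne_zero _).hasFDerivAt
          (A₀.hasFDerivAt.const_add q₀)
      · exact HasFDerivAt.comp x (hK.differentiable two_ne_zero _).hasFDerivAt
          ((A j).hasFDerivAt.const_add _)
    rw [h1.fderiv]
    simp
  obtain ⟨M₀, hM₀⟩ := hB.bounded
  obtain ⟨M₁, hM₁⟩ := hB.bounded_fderiv
  obtain ⟨L, hL⟩ := hB.lipschitz
  obtain ⟨⟨Z, P⟩, hcrit, hval⟩ := exists_critical_point_of_le hB.contDiff hM₀ hM₁ hL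
    (c := g q₀) (fun P => by
      simp only [B, A₀]
      have : 0 ≤ (N : ℝ)⁻¹ * ∑ j : Fin N, K ((q₀, 0, ((j : ℕ) : ℝ) / N) + A j (0, P)) :=
        mul_nonneg (by positivity) (Finset.sum_nonneg fun j _ => hK0 _)
      simpa using this)
  let Y : ℕ → E := fun j => q₀ - tailSum E N j Z
  let Q : ℕ → E := fun j => if h : j < N then P ⟨j, h⟩ else 0
  let z : ℕ → E × E := fun j => (Y j, gradient g (Y 0)
    + (N : ℝ)⁻¹ • ∑ i ∈ Finset.range j, (hamVF K (Y (i + 1), Q i, i / N)).2)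
  have hAx : ∀ j : Fin N, (q₀, 0, ((j : ℕ) : ℝ) / N) + A j (Z, P)
      = (Y (j + 1), Q j, (j : ℝ) / N) := by
    intro j
    simp [A, Y, Q, sub_eq_add_neg]
  have hA0x : q₀ + A₀ (Z, P) = Y 0 := by simp [A₀, Y, sub_eq_add_neg]
  simp only [hBd, hAx, hA0x] at hcrit
  have hYs : ∀ j (hj : j < N), Y (j + 1) - Y j = Z ⟨j, hj⟩ := by
    intro j hj
    rw [← tailSum_sub_succ hj]
    simp [Y]
  have hQz : ∀ j < N, (z j).2 = Q j := by
    intro i hi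
    refine ext_inner_right ℝ fun w => ?_
    have h1 := hcrit (PiLp.single 2 ⟨i, hi⟩ w, 0)
    have h2 : ∀ j : Fin N, fderiv ℝ K (Y (j + 1), Q j, ((j : ℕ) : ℝ) / N)
        (A j (PiLp.single 2 ⟨i, hi⟩ w, 0)) = if (j : ℕ) < i then
          -⟪(hamVF K (Y (j + 1), Q j, ((j : ℕ) : ℝ) / N)).2, w⟫ else 0 := by
      intro j
      have : A j (PiLp.single 2 ⟨i, hi⟩ w, 0) = -(if (j : ℕ) < i then w else 0, 0, 0) := by
        simp [A, tailSum_single]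
      rw [this, map_neg, ← inner_hamVF_snd]
      split_ifs <;> simp
    simp only [h2] at h1
    rw [Fin.sum_univ_eq_sum_range (fun j => if j < i then
          -⟪(hamVF K (Y (j + 1), Q j, (j : ℝ) / N)).2, w⟫ else 0) N, ← Finset.sum_filter] at h1
    have h3 : (Finset.range N).filter (· < i) = Finset.range i := by
      ext j
      simp
      omega
    have h4 : ⟪P, (PiLp.single 2 ⟨i, hi⟩ w : PathSpace E N)⟫ = ⟪Q i, w⟫ := by
      simp [inner_pathSpace_single, Q, hi]
    have h5 : A₀ (PiLp.single 2 ⟨i, hi⟩ w, 0) = -w := by simp [A₀, tailSum_single]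
    rw [h3, h4, h5] at h1
    simp only [z, inner_add_left, inner_smul_left, sum_inner, inner_gradient_left]
    simp at h1 ⊢
    linarith
  have hYz : ∀ j < N, Y (j + 1) - Y j = (N : ℝ)⁻¹ • (hamVF K (Y (j + 1), Q j, j / N)).1 := by
    intro i hi
    refine ext_inner_right ℝ fun w => ?_
    have h1 := hcrit (0, PiLp.single 2 ⟨i, hi⟩ w)
    have h2 : ∀ j : Fin N, fderiv ℝ K (Y (j + 1), Q j, ((j : ℕ) : ℝ) / N)
        (A j (0, PiLp.single 2 ⟨i, hi⟩ w)) = if j = ⟨i, hi⟩ then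
          -⟪(hamVF K (Y (j + 1), Q j, ((j : ℕ) : ℝ) / N)).1, w⟫ else 0 := by
      intro j
      have : A j (0, PiLp.single 2 ⟨i, hi⟩ w) = (0, if j = ⟨i, hi⟩ then w else 0, 0) := by
        simp [A]
      rw [this, inner_hamVF_fst, neg_neg]
      split_ifs
      · rfl
      · exact map_zero _
    simp only [h2] at h1
    have h4 : ⟪Z, (PiLp.single 2 ⟨i, hi⟩ w : PathSpace E N)⟫ = ⟪Z ⟨i, hi⟩, w⟫ := by
      simp [inner_pathSpace_single]
    rw [h4] at h1
    rw [hYs i hi, inner_smul_left]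
    simp [A₀] at h1 ⊢
    linarith
  refine ⟨z, ?_, ?_, ?_, ?_⟩
  · simp [z, Y, tailSum_self]
  · simp [z]
  · intro j hj
    rw [hQz j hj]
    refine Prod.ext ?_ ?_
    · simp only [Prod.fst_add, Prod.smul_fst]
      rw [← hYz j hj]
      simp [z]
    · simp [z, Finset.sum_range_succ, add_assoc]
  · refine hval.trans_eq ?_
    simp only [B, hAx, hA0x]
    rw [Finset.sum_add_distrib, ← Finset.mul_sum,
      Fin.sum_univ_eq_sum_range (fun j => K (Y (j + 1), Q j, (j : ℝ) / N)) N]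
    have h1 : ⟪P, Z⟫ = ∑ j ∈ Finset.range N, ⟪(z j).2, (z (j + 1)).1 - (z j).1⟫ := by
      rw [← Fin.sum_univ_eq_sum_range (fun j => ⟪(z j).2, (z (j + 1)).1 - (z j).1⟫) N,
        PiLp.inner_apply]
      refine Finset.sum_congr rfl fun j _ => ?_
      rw [hQz j j.2]
      simp [z, hYs j j.2, Q]
    have h2 : ∑ j ∈ Finset.range N, K ((z (j + 1)).1, (z j).2, (j : ℝ) / N)
        = ∑ j ∈ Finset.range N, K (Y (j + 1), Q j, (j : ℝ) / N) :=
      Finset.sum_congr rfl fun j hj => by rw [hQz j (Finset.mem_range.1 hj)]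
    rw [h1, h2]
    ring

end Discretization

/-! ### Convergence of the discrete trajectories -/

section Convergence

theorem norm_discrete_sub_le {Z : Type*} [NormedAddCommGroup Z] [NormedSpace ℝ Z]
    {f : Z → ℝ → Z} {L M D : ℝ} (hL0 : 0 ≤ L) (hD0 : 0 ≤ D)
    (hL : ∀ x y s t, ‖f x s - f y t‖ ≤ L * (‖x - y‖ + |s - t|)) (hM : ∀ x t, ‖f x t‖ ≤ M)
    {γ : ℝ → Z} (hγ : ∀ t ∈ Icc (0 : ℝ) 1, HasDerivAt γ (f (γ t) t) t)
    {N : ℕ} (hN : 0 < N) {ζ : ℕ → Z} (h0 : ζ 0 = γ 0)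
    (hζ : ∀ j < N, ‖ζ (j + 1) - ζ j - (N : ℝ)⁻¹ • f (ζ j) (j / N)‖ ≤ D / N ^ 2) :
    ‖ζ N - γ 1‖ ≤ (D + L * (M + 1)) * Real.exp L / N := by
  have hM0 : 0 ≤ M := (norm_nonneg _).trans (hM (γ 0) 0)
  have hN' : (0 : ℝ) < N := Nat.cast_pos.2 hN
  have hlocal : ∀ a ∈ Icc (0 : ℝ) 1, ∀ b ∈ Icc (0 : ℝ) 1, a ≤ b →
      ‖γ b - γ a - (b - a) • f (γ a) a‖ ≤ L * (M + 1) * (b - a) ^ 2 := by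
    intro a ha b hb hab
    have hsub : ∀ x ∈ Icc a b, x ∈ Icc (0 : ℝ) 1 := fun x hx => ⟨ha.1.trans hx.1, hx.2.trans hb.2⟩
    have h1 : ∀ x ∈ Icc a b, ‖γ x - γ a‖ ≤ M * (x - a) :=
      norm_image_sub_le_of_norm_deriv_le_segment'
        (fun x hx => (hγ x (hsub x hx)).hasDerivWithinAt) (fun x _ => hM _ _)
    have h2 := norm_image_sub_le_of_norm_deriv_le_segment' (a := a) (b := b)
      (f := fun x => γ x - (x - a) • f (γ a) a) (f' := fun x => f (γ x) x - f (γ a) a)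
      (C := L * (M + 1) * (b - a))
      (fun x hx => by
        have := (hγ x (hsub x hx)).fun_sub (((hasDerivAt_id x).sub_const a).smul_const (f (γ a) a))
        simpa using this.hasDerivWithinAt)
      (fun x hx => by
        have hx' := Ico_subset_Icc_self hx
        refine (hL _ _ _ _).trans ?_
        rw [mul_assoc]
        refine mul_le_mul_of_nonneg_left ?_ hL0
        rw [abs_of_nonneg (sub_nonneg.2 hx'.1)]
        have := h1 x hx'
        have h3 : (M + 1) * (x - a) ≤ (M + 1) * (b - a) :=
          mul_le_mul_of_nonneg_left (by linarith [hx'.2]) (by linarith)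
        linarith) b ⟨hab, le_rfl⟩
    simp only [sub_self, zero_smul, sub_zero] at h2
    rw [sub_right_comm] at h2
    exact h2.trans_eq (by ring)
  set D' := D + L * (M + 1) with hD'
  have hD'0 : 0 ≤ D' := by positivity
  have hstep : ∀ j ≤ N, ‖ζ j - γ (j / N)‖ ≤ j * (D' / N ^ 2) * (1 + L / N) ^ j := by
    intro j
    induction j with
    | zero => simp [h0]
    | succ j ih =>
      intro hj
      have ih := ih (by omega)
      have hmem : ∀ i : ℕ, i ≤ N → (i : ℝ) / N ∈ Icc (0 : ℝ) 1 := fun i hi =>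
        ⟨by positivity, (div_le_one hN').2 (by exact_mod_cast hi)⟩
      have hb : ((j + 1 : ℕ) : ℝ) / N - j / N = (N : ℝ)⁻¹ := by push_cast; field_simp; ring
      have h1 := hlocal _ (hmem j (by omega)) _ (hmem (j + 1) hj) (by gcongr; simp)
      rw [hb] at h1
      have h2 := hζ j (by omega)
      have h3 := hL (ζ j) (γ (j / N)) (j / N) (j / N)
      rw [sub_self, abs_zero, add_zero] at h3
      have h4 : ζ (j + 1) - γ ((j + 1 : ℕ) / N)
          = (ζ (j + 1) - ζ j - (N : ℝ)⁻¹ • f (ζ j) (j / N))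
            - (γ ((j + 1 : ℕ) / N) - γ (j / N) - (N : ℝ)⁻¹ • f (γ (j / N)) (j / N))
            + ((ζ j - γ (j / N)) + (N : ℝ)⁻¹ • (f (ζ j) (j / N) - f (γ (j / N)) (j / N))) := by
        module
      have h5 : ‖(N : ℝ)⁻¹ • (f (ζ j) (j / N) - f (γ (j / N)) (j / N))‖
          ≤ (N : ℝ)⁻¹ * (L * ‖ζ j - γ (j / N)‖) := by
        rw [norm_smul, norm_inv, Real.norm_natCast]
        gcongr
      have h6 : ‖ζ (j + 1) - γ ((j + 1 : ℕ) / N)‖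
          ≤ D' / N ^ 2 + (1 + L / N) * ‖ζ j - γ (j / N)‖ := by
        rw [h4]
        refine (norm_add_le _ _).trans (add_le_add ((norm_sub_le _ _).trans ?_)
          ((norm_add_le _ _).trans ?_))
        · refine (add_le_add h2 h1).trans_eq ?_
          rw [hD']
          field_simp
        · refine (add_le_add le_rfl h5).trans_eq ?_
          field_simp
      have h7 : (1 : ℝ) ≤ (1 + L / N) ^ (j + 1) :=
        one_le_pow₀ (by linarith [div_nonneg hL0 hN'.le])
      calc _ ≤ D' / N ^ 2 + (1 + L / N) * ‖ζ j - γ (j / N)‖ := h6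
        _ ≤ D' / N ^ 2 * (1 + L / N) ^ (j + 1)
            + (1 + L / N) * (j * (D' / N ^ 2) * (1 + L / N) ^ j) := by
          refine add_le_add (le_mul_of_one_le_right (by positivity) h7) ?_
          gcongr
        _ = _ := by
          push_cast
          ring
  have h := hstep N le_rfl
  rw [div_self hN'.ne'] at h
  refine h.trans ?_
  have h8 : (1 + L / N) ^ N ≤ Real.exp L := by
    calc (1 + L / N) ^ N ≤ Real.exp (L / N) ^ N := by
          gcongr
          linarith [Real.add_one_le_exp (L / N)]
      _ = Real.exp L := by
          rw [← Real.exp_nat_mul]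
          congr 1
          field_simp
  calc N * (D' / N ^ 2) * (1 + L / N) ^ N ≤ N * (D' / N ^ 2) * Real.exp L := by gcongr
    _ = _ := by field_simp

variable {E : Type*} [NormedAddCommGroup E]

theorem exp_le_norm_of_step {Y : ℕ → E} {C : ℝ} {N : ℕ} (hN : 0 < N) (hC0 : 0 ≤ C)
    (hCN : 2 * C ≤ N) (hYN : ‖Y N‖ = 1)
    (hY : ∀ j < N, ‖Y (j + 1) - Y j‖ ≤ (N : ℝ)⁻¹ * (C * ‖Y (j + 1)‖)) :
    ∀ j ≤ N, ‖Y j‖ ∈ Icc (Real.exp (-(2 * C))) (Real.exp (2 * C)) := by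
  have hN' : (0 : ℝ) < N := Nat.cast_pos.2 hN
  set x : ℝ := C / N with hx
  have hx0 : 0 ≤ x := by positivity
  have hx1 : 2 * x ≤ 1 := by
    rw [hx, ← mul_div_assoc]
    exact (div_le_one hN').2 hCN
  have key : ∀ k ≤ N, ‖Y (N - k)‖ ∈ Icc (Real.exp (-(2 * x * k))) (Real.exp (2 * x * k)) := by
    intro k
    induction k with
    | zero => simp [hYN]
    | succ k ih =>
      intro hk
      have ih := ih (by omega)
      have h1 := hY (N - (k + 1)) (by omega)
      rw [show N - (k + 1) + 1 = N - k by omega] at h1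
      set a := Y (N - k)
      set b := Y (N - (k + 1))
      have h2 : ‖a - b‖ ≤ x * ‖a‖ := h1.trans_eq (by rw [hx]; ring)
      have h3 := norm_sub_norm_le a b
      have h4 := norm_sub_norm_le b a
      rw [norm_sub_rev] at h4
      have h5 := Real.add_one_le_exp (2 * x)
      have ha := norm_nonneg a
      have hb := norm_nonneg b
      have h6 : ‖a‖ ≤ Real.exp (2 * x) * ‖b‖ := by
        have : ‖a‖ ≤ (1 + 2 * x) * ‖b‖ := by
          nlinarith [mul_nonneg hx0 (sub_nonneg.2 hx1)]
        nlinarith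
      have h7 : ‖b‖ ≤ Real.exp (2 * x) * ‖a‖ := by nlinarith
      push_cast
      constructor
      · rw [show -(2 * x * ((k : ℝ) + 1)) = -(2 * x) + -(2 * x * k) by ring, Real.exp_add]
        calc Real.exp (-(2 * x)) * Real.exp (-(2 * x * k)) ≤ Real.exp (-(2 * x)) * ‖a‖ := by
              gcongr
              exact ih.1
          _ ≤ Real.exp (-(2 * x)) * (Real.exp (2 * x) * ‖b‖) := by gcongr
          _ = ‖b‖ := by rw [← mul_assoc, ← Real.exp_add]; simp
      · rw [show 2 * x * ((k : ℝ) + 1) = 2 * x + 2 * x * k by ring, Real.exp_add]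
        refine h7.trans ?_
        gcongr
        exact ih.2
  intro j hj
  have h1 := key (N - j) (by omega)
  rw [show N - (N - j) = j by omega] at h1
  have h2 : 2 * x * ((N - j : ℕ) : ℝ) ≤ 2 * C := by
    have : ((N - j : ℕ) : ℝ) ≤ N := by exact_mod_cast Nat.sub_le N j
    calc 2 * x * ((N - j : ℕ) : ℝ) ≤ 2 * x * N := by gcongr
      _ = 2 * C := by rw [hx]; field_simp
  exact ⟨(Real.exp_le_exp.2 (neg_le_neg h2)).trans h1.1, h1.2.trans (Real.exp_le_exp.2 h2)⟩

variable [InnerProductSpace ℝ E] [FiniteDimensional ℝ E]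

/-- The action of a discrete trajectory is its final value `⟪P, Y⟫` when the Hamiltonian and the
initial function satisfy Euler's identity for functions homogeneous of degree one in `Y`. -/
theorem action_eq_inner {K : E × E × ℝ → ℝ} {g : E → ℝ} {N : ℕ} {z : ℕ → E × E}
    (h0 : (z 0).2 = gradient g (z 0).1)
    (hz : ∀ j < N, z (j + 1) = z j + (N : ℝ)⁻¹ • hamVF K ((z (j + 1)).1, (z j).2, j / N))
    (hg : fderiv ℝ g (z 0).1 (z 0).1 = g (z 0).1)
    (hK : ∀ j < N, fderiv ℝ K ((z (j + 1)).1, (z j).2, j / N) ((z (j + 1)).1, 0, 0)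
      = K ((z (j + 1)).1, (z j).2, j / N)) :
    g (z 0).1 + ∑ j ∈ Finset.range N, (⟪(z j).2, (z (j + 1)).1 - (z j).1⟫
        + (N : ℝ)⁻¹ * K ((z (j + 1)).1, (z j).2, j / N)) = ⟪(z N).2, (z N).1⟫ := by
  have h1 : ∀ j ∈ Finset.range N, ⟪(z j).2, (z (j + 1)).1 - (z j).1⟫
        + (N : ℝ)⁻¹ * K ((z (j + 1)).1, (z j).2, j / N)
      = ⟪(z (j + 1)).2, (z (j + 1)).1⟫ - ⟪(z j).2, (z j).1⟫ := by
    intro j hj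
    have h2 : (z (j + 1)).2
        = (z j).2 + (N : ℝ)⁻¹ • (hamVF K ((z (j + 1)).1, (z j).2, j / N)).2 :=
      congrArg Prod.snd (hz j (Finset.mem_range.1 hj))
    rw [← hK j (Finset.mem_range.1 hj), ← inner_hamVF_snd, h2, inner_add_left, inner_smul_left,
      inner_sub_right]
    simp
    ring
  rw [Finset.sum_congr rfl h1, Finset.sum_range_sub (fun j => ⟪(z j).2, (z j).1⟫) N, h0,
    inner_gradient_left, hg]
  ring

/-- If the continuous trajectories issued from the graph of `∇g` project to a cone over a family
`q`, the fibre over `q₀` is reached with `⟪P, q₀⟫` at least `g q₀`. -/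
theorem exists_trajectory_of_cone {K : E × E × ℝ → ℝ} (hK : ContDiff ℝ 2 K)
    (hKc : HasCompactSupport K) (hK0 : ∀ x, 0 ≤ K x) {g : E → ℝ} (hg : ContDiff ℝ 2 g)
    (hgc : HasCompactSupport g) {C : ℝ} (hC0 : 0 ≤ C)
    (hKP : ∀ x : E × E × ℝ, ‖(hamVF K x).1‖ ≤ C * ‖x.1‖)
    (hKe : ∀ x : E × E × ℝ, ‖x.1‖ ∈ Icc (Real.exp (-(2 * C))) (Real.exp (2 * C)) →
      fderiv ℝ K x (x.1, 0, 0) = K x)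
    (hge : ∀ Y : E, ‖Y‖ ∈ Icc (Real.exp (-(2 * C))) (Real.exp (2 * C)) → fderiv ℝ g Y Y = g Y)
    {q P : E → ℝ → E} (hq : ContinuousOn (fun s => q s 1) (sphere 0 1))
    (hP : ContinuousOn (fun s => P s 1) (sphere 0 1))
    (htraj : ∀ s ∈ sphere (0 : E) 1, ∀ r ∈ Icc (Real.exp (-(2 * C))) (Real.exp (2 * C)),
      ∀ t ∈ Icc (0 : ℝ) 1, HasDerivAt (fun τ => (r • q s τ, P s τ))
        (hamVF K (r • q s t, P s t, t)) t)
    (hq0 : ∀ s ∈ sphere (0 : E) 1, q s 0 = s)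
    (hP0 : ∀ s ∈ sphere (0 : E) 1, ∀ r ∈ Icc (Real.exp (-(2 * C))) (Real.exp (2 * C)),
      gradient g (r • s) = P s 0)
    (hq1 : ∀ s ∈ sphere (0 : E) 1, ‖q s 1‖ = 1) {q₀ : E} (hq₀ : q₀ ∈ sphere (0 : E) 1) :
    ∃ s ∈ sphere (0 : E) 1, q s 1 = q₀ ∧ g q₀ ≤ ⟪P s 1, q₀⟫ := by
  set I := Icc (Real.exp (-(2 * C))) (Real.exp (2 * C)) with hI
  have hq₀' : ‖q₀‖ = 1 := by simpa using hq₀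
  have hVc := contDiff_hamVF hK
  obtain ⟨L, hL⟩ := hVc.lipschitzWith_of_hasCompactSupport (hasCompactSupport_hamVF hKc)
    one_ne_zero
  obtain ⟨M, hM⟩ := (hasCompactSupport_hamVF hKc).exists_bound_of_continuous hVc.continuous
  have hM0 : 0 ≤ M := le_trans (norm_nonneg (hamVF K 0)) (hM 0)
  set C' := (L * M + L * (M + 1)) * Real.exp L with hC'
  have happrox : ∀ N : ℕ, 0 < N → 2 * C ≤ N → ∃ s ∈ sphere (0 : E) 1, ∃ r ∈ I,
      ‖q₀ - r • q s 1‖ ≤ C' / N ∧ g q₀ - ⟪P s 1, q₀⟫ ≤ C' / N := by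
    intro N hN hCN
    have hN' : (0 : ℝ) < N := Nat.cast_pos.2 hN
    obtain ⟨z, hzN, hz0, hz, hval⟩ := exists_discrete_trajectory hK hKc hK0 hg hgc q₀ N
    have hz1 : ∀ j < N, z (j + 1) - z j
        = (N : ℝ)⁻¹ • hamVF K ((z (j + 1)).1, (z j).2, j / N) := fun j hj =>
      sub_eq_iff_eq_add'.2 (hz j hj)
    have hnorm := exp_le_norm_of_step (Y := fun j => (z j).1) hN hC0 hCN
      (by rw [hzN, hq₀']) (fun j hj => by
        have : (z (j + 1)).1 - (z j).1 = (N : ℝ)⁻¹ • (hamVF K ((z (j + 1)).1, (z j).2, j / N)).1 :=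
          congrArg Prod.fst (hz1 j hj)
        rw [this, norm_smul, norm_inv, Real.norm_natCast]
        exact mul_le_mul_of_nonneg_left (hKP _) (by positivity))
    rw [action_eq_inner hz0 hz (hge _ (hnorm 0 (Nat.zero_le _)))
      (fun j hj => hKe _ (hnorm (j + 1) hj)), hzN] at hval
    have hr : ‖(z 0).1‖ ∈ I := hnorm 0 (Nat.zero_le _)
    have hrpos : 0 < ‖(z 0).1‖ := (Real.exp_pos _).trans_le hr.1
    set r := ‖(z 0).1‖ with hrdef
    set s := r⁻¹ • (z 0).1 with hsdef
    have hs : s ∈ sphere (0 : E) 1 := by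
      rw [mem_sphere_zero_iff_norm, hsdef, norm_smul, norm_inv, norm_norm,
        inv_mul_cancel₀ hrpos.ne']
    have hrs : r • s = (z 0).1 := smul_inv_smul₀ hrpos.ne' _
    have hconv : ‖z N - (r • q s 1, P s 1)‖ ≤ C' / N :=
      norm_discrete_sub_le (f := fun x t => hamVF K (x.1, x.2, t)) (L := (L : ℝ))
        (M := M) (D := L * M) L.2 (mul_nonneg L.2 hM0)
        (fun x y a b => by
          rw [← dist_eq_norm]
          refine (hL.dist_le_mul _ _).trans (mul_le_mul_of_nonneg_left ?_ L.2)
          rw [dist_eq_norm, Prod.norm_def, Prod.norm_def, Prod.norm_def, Real.norm_eq_abs]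
          simp only [Prod.fst_sub, Prod.snd_sub]
          rw [← max_assoc]
          exact max_le_add_of_nonneg (by positivity) (abs_nonneg _))
        (fun x t => hM _) (htraj s hs r hr) hN
        (by
          rw [hq0 s hs, hrs, ← hP0 s hs r hr, hrs, ← hz0])
        (fun j hj => by
          rw [hz1 j hj, ← smul_sub, norm_smul, norm_inv, Real.norm_natCast, ← dist_eq_norm]
          have h1 : dist ((z (j + 1)).1, (z j).2, (j : ℝ) / N) ((z j).1, (z j).2, (j : ℝ) / N)
              ≤ (N : ℝ)⁻¹ * M := by
            rw [Prod.dist_eq, dist_self, max_eq_left dist_nonneg, dist_eq_norm]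
            refine (norm_fst_le (z (j + 1) - z j)).trans ?_
            rw [hz1 j hj, norm_smul, norm_inv, Real.norm_natCast]
            exact mul_le_mul_of_nonneg_left (hM _) (by positivity)
          calc _ ≤ (N : ℝ)⁻¹ * (L * ((N : ℝ)⁻¹ * M)) := by
                gcongr
                exact (hL.dist_le_mul _ _).trans (mul_le_mul_of_nonneg_left h1 L.2)
            _ = _ := by ring)
    have hc1 := (norm_fst_le _).trans hconv
    have hc2 := (norm_snd_le _).trans hconv
    simp only [Prod.fst_sub, Prod.snd_sub, hzN] at hc1 hc2
    refine ⟨s, hs, r, hr, hc1, ?_⟩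
    have h2 : ⟪(z N).2 - P s 1, q₀⟫ ≤ C' / N := by
      refine (real_inner_le_norm _ _).trans ?_
      rwa [hq₀', mul_one]
    rw [inner_sub_left] at h2
    linarith
  set φ : E × ℝ → ℝ := fun x => max ‖q₀ - x.2 • q x.1 1‖ (g q₀ - ⟪P x.1 1, q₀⟫) with hφ
  have hφc : ContinuousOn φ (sphere (0 : E) 1 ×ˢ I) := by
    have h1 : ContinuousOn (fun x : E × ℝ => q x.1 1) (sphere (0 : E) 1 ×ˢ I) :=
      hq.comp continuousOn_fst fun x hx => hx.1
    have h2 : ContinuousOn (fun x : E × ℝ => P x.1 1) (sphere (0 : E) 1 ×ˢ I) :=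
      hP.comp continuousOn_fst fun x hx => hx.1
    exact (continuousOn_const.sub (continuousOn_snd.smul h1)).norm.sup
      (continuousOn_const.sub (h2.inner continuousOn_const))
  have hne : (sphere (0 : E) 1 ×ˢ I).Nonempty :=
    ⟨(q₀, Real.exp (2 * C)), hq₀, Real.exp_le_exp.2 (by linarith), le_rfl⟩
  obtain ⟨⟨s, r⟩, ⟨hs, hr⟩, hmin⟩ :=
    ((isCompact_sphere (0 : E) 1).prod isCompact_Icc).exists_isMinOn hne hφc
  have hle : φ (s, r) ≤ 0 := by
    refine le_of_forall_pos_le_add fun ε hε => ?_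
    obtain ⟨N, hN⟩ := exists_nat_gt (max (2 * C) (C' / ε))
    have hN0 : (0 : ℝ) < N := (le_max_left _ _ |>.trans' (by positivity)).trans_lt hN
    obtain ⟨s', hs', r', hr', h1, h2⟩ := happrox N (by exact_mod_cast hN0)
      ((le_max_left _ _).trans hN.le)
    have h3 : C' / N ≤ ε := by
      rw [div_le_iff₀ hN0, mul_comm]
      exact (div_le_iff₀ hε).1 ((le_max_right _ _).trans hN.le)
    have h4 : φ (s, r) ≤ φ (s', r') := hmin ⟨hs', hr'⟩
    rw [zero_add]
    exact h4.trans ((max_le h1 h2).trans h3)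
  have h1 : q₀ = r • q s 1 :=
    sub_eq_zero.1 (norm_le_zero_iff.1 ((le_max_left _ _).trans hle))
  have h2 : g q₀ - ⟪P s 1, q₀⟫ ≤ 0 := (le_max_right _ _).trans hle
  have hr0 : 0 < r := (Real.exp_pos _).trans_le hr.1
  have h3 : r = 1 := by
    have := congrArg norm h1
    rwa [hq₀', norm_smul, hq1 s hs, mul_one, Real.norm_eq_abs, abs_of_pos hr0, eq_comm] at this
  exact ⟨s, hs, by rw [h1, h3, one_smul], by linarith⟩

end Convergence

/-! ### Homogenization -/

section Homogenization

open Topology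

theorem exists_smooth_cutoff {X : Type*} [NormedAddCommGroup X] [NormedSpace ℝ X]
    [FiniteDimensional ℝ X] {A U : Set X} (hA : IsCompact A) (hU : IsOpen U) (hAU : A ⊆ U) :
    ∃ χ : X → ℝ, ContDiff ℝ (⊤ : ℕ∞) χ ∧ HasCompactSupport χ ∧ tsupport χ ⊆ U ∧
      (∀ x, χ x ∈ Icc (0 : ℝ) 1) ∧ ∀ x ∈ A, χ =ᶠ[𝓝 x] 1 := by
  obtain ⟨L, hL, hAL, hLU⟩ := exists_compact_between hA hU hAU
  obtain ⟨χ, h1, h0, h⟩ := exists_contMDiffMap_one_nhds_of_subset_interior (n := (⊤ : ℕ∞))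
    (modelWithCornersSelf ℝ X) hA.isClosed hAL
  have hsupp : Function.support χ ⊆ L := fun x hx => by
    by_contra hxL
    exact hx (h0 x hxL)
  refine ⟨χ, χ.contMDiff.contDiff, HasCompactSupport.of_support_subset_isCompact hL hsupp,
    (closure_minimal hsupp hL.isClosed).trans hLU, h, fun x hx => ?_⟩
  exact Filter.eventually_of_mem (mem_nhdsSet_iff_forall.1 h1 x hx) fun _ => id

theorem exists_bound_fderiv {X : Type*} [NormedAddCommGroup X] [NormedSpace ℝ X] {κ : X → ℝ}
    (hκ : ContDiff ℝ 1 κ) (hκc : HasCompactSupport κ) : ∃ C, ∀ x, ‖fderiv ℝ κ x‖ ≤ C :=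
  (hκc.fderiv ℝ).exists_bound_of_continuous (hκ.continuous_fderiv one_ne_zero)

theorem contDiff_mul_of_tsupport_subset {X : Type*} [NormedAddCommGroup X] [NormedSpace ℝ X]
    {n : WithTop ℕ∞} {χ f : X → ℝ} {U : Set X} (hχ : ContDiff ℝ n χ) (hU : tsupport χ ⊆ U)
    (hf : ∀ x ∈ U, ContDiffAt ℝ n f x) : ContDiff ℝ n fun x => χ x * f x := by
  rw [contDiff_iff_contDiffAt]
  intro x
  by_cases hx : x ∈ tsupport χ
  · exact hχ.contDiffAt.mul (hf x (hU hx))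
  · refine (contDiffAt_const (c := (0 : ℝ))).congr_of_eventuallyEq ?_
    filter_upwards [notMem_tsupport_iff_eventuallyEq.1 hx] with y hy
    simp [hy]

variable {E : Type*} [NormedAddCommGroup E] [InnerProductSpace ℝ E]

theorem hasFDerivAt_norm_inner {Y : E} (hY : Y ≠ 0) :
    HasFDerivAt (fun Y : E => ‖Y‖) (innerSL ℝ (‖Y‖⁻¹ • Y)) Y := by
  have h1 := ((contDiffAt_norm ℝ hY (n := 1)).differentiableAt one_ne_zero).hasFDerivAt
  have h2 := (h1.pow 2).unique (hasStrictFDerivAt_norm_sq Y).hasFDerivAt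
  refine h1.congr_fderiv (ContinuousLinearMap.ext fun v => ?_)
  have h3 := congrArg (fun L : E →L[ℝ] ℝ => L v) h2
  have hY' : ‖Y‖ ≠ 0 := norm_ne_zero_iff.2 hY
  simp at h3
  simp
  field_simp
  linarith

theorem hasFDerivAt_normalize {Y : E} (hY : Y ≠ 0) :
    HasFDerivAt (fun Y : E => ‖Y‖⁻¹ • Y) (‖Y‖⁻¹ • (ContinuousLinearMap.id ℝ E
      - (innerSL ℝ (‖Y‖⁻¹ • Y)).smulRight (‖Y‖⁻¹ • Y))) Y := by
  have hY' : ‖Y‖ ≠ 0 := norm_ne_zero_iff.2 hY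
  have h1 := ((hasDerivAt_inv hY').comp_hasFDerivAt Y (hasFDerivAt_norm_inner hY)).smul
    (hasFDerivAt_id Y)
  refine h1.congr_fderiv (ContinuousLinearMap.ext fun v => ?_)
  simp
  match_scalars <;> field_simp

/-- The derivative of the extension of `f` which is homogeneous of degree one in `Y`. -/
theorem hasFDerivAt_homogeneous {X : Type*} [NormedAddCommGroup X] [NormedSpace ℝ X]
    {f : E × X → ℝ} {Y : E} {x : X} (hY : Y ≠ 0)
    (hf : DifferentiableAt ℝ f (‖Y‖⁻¹ • Y, x)) {χ : E → ℝ} (hχ : χ =ᶠ[𝓝 Y] 1) :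
    ∃ D : E × X →L[ℝ] ℝ,
      HasFDerivAt (fun y : E × X => χ y.1 * (‖y.1‖ * f (‖y.1‖⁻¹ • y.1, y.2))) D (Y, x) ∧
      ∀ v w, D (v, w) = ⟪‖Y‖⁻¹ • Y, v⟫ * f (‖Y‖⁻¹ • Y, x)
        + fderiv ℝ f (‖Y‖⁻¹ • Y, x) (v - ⟪‖Y‖⁻¹ • Y, v⟫ • ‖Y‖⁻¹ • Y, ‖Y‖ • w) := by
  have hY' : ‖Y‖ ≠ 0 := norm_ne_zero_iff.2 hY
  have h1 : HasFDerivAt (fun y : E × X => y.1) (.fst ℝ E X) (Y, x) := hasFDerivAt_fst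
  have h2 : HasFDerivAt (fun y : E × X => (‖y.1‖⁻¹ • y.1, y.2)) _ (Y, x) :=
    (HasFDerivAt.comp (Y, x) (hasFDerivAt_normalize hY) h1).prodMk hasFDerivAt_snd
  have h3 := (HasFDerivAt.comp (Y, x) (hasFDerivAt_norm_inner hY) h1).mul
    (HasFDerivAt.comp (Y, x) hf.hasFDerivAt h2)
  refine ⟨_, h3.congr_of_eventuallyEq ?_, fun v w => ?_⟩
  · filter_upwards [(continuous_fst.tendsto (Y, x)).eventually hχ] with y hy
    simp [hy]
  · have h4 : ((v - ⟪‖Y‖⁻¹ • Y, v⟫ • ‖Y‖⁻¹ • Y, ‖Y‖ • w) : E × X)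
        = ‖Y‖ • (‖Y‖⁻¹ • (v - ⟪‖Y‖⁻¹ • Y, v⟫ • ‖Y‖⁻¹ • Y), w) := by
      rw [Prod.smul_mk, smul_inv_smul₀ hY']
    rw [h4, map_smul]
    simp [-Prod.smul_mk, real_inner_smul_left]
    ring

variable [FiniteDimensional ℝ E]

/-- A positive contact Hamiltonian trajectory of the graph of `∇h`, in the coordinates
`(q, P = p + u q)`, reaches every fibre above the graph. -/
theorem exists_trajectory_of_contactHamiltonian {κ : E × E × ℝ → ℝ} (hκ : ContDiff ℝ 2 κ)
    (hκc : HasCompactSupport κ) (hκ0 : ∀ x, 0 ≤ κ x) {h : E → ℝ} (hh : ContDiff ℝ 2 h)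
    {q P q' P' : E → ℝ → E} (hqc : ContinuousOn (fun s => q s 1) (sphere 0 1))
    (hPc : ContinuousOn (fun s => P s 1) (sphere 0 1))
    (hq : ∀ s ∈ sphere (0 : E) 1, ∀ t ∈ Icc (0 : ℝ) 1, HasDerivAt (q s) (q' s t) t)
    (hP : ∀ s ∈ sphere (0 : E) 1, ∀ t ∈ Icc (0 : ℝ) 1, HasDerivAt (P s) (P' s t) t)
    (hq1 : ∀ s ∈ sphere (0 : E) 1, ∀ t ∈ Icc (0 : ℝ) 1, ‖q s t‖ = 1)
    (hval : ∀ s ∈ sphere (0 : E) 1, ∀ t ∈ Icc (0 : ℝ) 1, κ (q s t, P s t, t) = ⟪q s t, P' s t⟫)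
    (hder : ∀ s ∈ sphere (0 : E) 1, ∀ t ∈ Icc (0 : ℝ) 1, ∀ w z : E,
      fderiv ℝ κ (q s t, P s t, t) (w, z, 0) = ⟪P' s t, w⟫ - ⟪q' s t, z⟫)
    (hq0 : ∀ s ∈ sphere (0 : E) 1, q s 0 = s)
    (hP0 : ∀ s ∈ sphere (0 : E) 1,
      P s 0 = h s • s + (gradient h s - ⟪gradient h s, s⟫ • s))
    {q₀ : E} (hq₀ : q₀ ∈ sphere (0 : E) 1) :
    ∃ s ∈ sphere (0 : E) 1, q s 1 = q₀ ∧ h q₀ ≤ ⟪P s 1, q₀⟫ := by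
  obtain ⟨C, hC⟩ := exists_bound_fderiv (hκ.of_le one_le_two) hκc
  have hC0 : 0 ≤ C := le_trans (norm_nonneg (fderiv ℝ κ 0)) (hC 0)
  set I := Icc (Real.exp (-(2 * C))) (Real.exp (2 * C)) with hI
  obtain ⟨χ, hχ, hχc, hχU, hχ01, hχ1⟩ := exists_smooth_cutoff (A := {Y : E | ‖Y‖ ∈ I})
    (U := {0}ᶜ)
    (by
      refine (isCompact_closedBall (0 : E) (Real.exp (2 * C))).of_isClosed_subset
        (isClosed_Icc.preimage continuous_norm) fun Y hY => ?_
      simpa using hY.2)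
    isOpen_compl_singleton
    (fun Y hY h0 => by
      rw [mem_singleton_iff] at h0
      have := hY.1
      rw [h0, norm_zero] at this
      exact absurd this (not_le.2 (Real.exp_pos _)))
  have hne : ∀ {Y : E}, ‖Y‖ ∈ I → Y ≠ 0 := fun hY => norm_pos_iff.1 ((Real.exp_pos _).trans_le hY.1)
  have hχ2 : ContDiff ℝ 2 χ := by simpa using contDiff_infty.1 hχ 2
  have hsph : ∀ {s : E}, s ∈ sphere (0 : E) 1 → ‖s‖ = 1 := fun hs => by simpa using hs
  have hscale : ∀ {r : ℝ} {n : E}, r ∈ I → ‖n‖ = 1 → ‖r • n‖ = r := fun {r n} hr hn => by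
    rw [norm_smul, hn, mul_one, Real.norm_eq_abs, abs_of_pos ((Real.exp_pos _).trans_le hr.1)]
  have hpos : ∀ {r : ℝ}, r ∈ I → 0 < r := fun hr => (Real.exp_pos _).trans_le hr.1
  have hnormc : ∀ Y : E, Y ≠ 0 → ContDiffAt ℝ 2 (fun Y : E => ‖Y‖) Y := fun Y hY =>
    contDiffAt_norm ℝ hY
  have hinvc : ∀ Y : E, Y ≠ 0 → ContDiffAt ℝ 2 (fun Y : E => ‖Y‖⁻¹ • Y) Y := fun Y hY =>
    ((hnormc Y hY).inv (norm_ne_zero_iff.2 hY)).smul contDiffAt_id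
  have hunit : ∀ {Y : E}, Y ≠ 0 → Y - ⟪‖Y‖⁻¹ • Y, Y⟫ • ‖Y‖⁻¹ • Y = 0 ∧ ⟪‖Y‖⁻¹ • Y, Y⟫ = ‖Y‖ := by
    intro Y hY
    have hY' : ‖Y‖ ≠ 0 := norm_ne_zero_iff.2 hY
    have : ⟪‖Y‖⁻¹ • Y, Y⟫ = ‖Y‖ := by
      rw [real_inner_smul_left, real_inner_self_eq_norm_sq]
      field_simp
    rw [this, smul_inv_smul₀ hY', sub_self]
    exact ⟨rfl, rfl⟩
  set K : E × E × ℝ → ℝ := fun y => χ y.1 * (‖y.1‖ * κ (‖y.1‖⁻¹ • y.1, y.2)) with hKdef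
  set g : E → ℝ := fun Y => χ Y * (‖Y‖ * h (‖Y‖⁻¹ • Y)) with hgdef
  have hKder : ∀ Y x, ‖Y‖ ∈ I → ∀ v w, fderiv ℝ K (Y, x) (v, w)
      = ⟪‖Y‖⁻¹ • Y, v⟫ * κ (‖Y‖⁻¹ • Y, x)
        + fderiv ℝ κ (‖Y‖⁻¹ • Y, x) (v - ⟪‖Y‖⁻¹ • Y, v⟫ • ‖Y‖⁻¹ • Y, ‖Y‖ • w) := by
    intro Y x hY v w
    obtain ⟨D, hD, hDv⟩ := hasFDerivAt_homogeneous (x := x) (hne hY)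
      (hκ.differentiable two_ne_zero _) (hχ1 Y hY)
    rw [hD.fderiv, hDv]
  have hgder : ∀ Y, ‖Y‖ ∈ I → ∀ v, fderiv ℝ g Y v = ⟪‖Y‖⁻¹ • Y, v⟫ * h (‖Y‖⁻¹ • Y)
        + fderiv ℝ h (‖Y‖⁻¹ • Y) (v - ⟪‖Y‖⁻¹ • Y, v⟫ • ‖Y‖⁻¹ • Y) := by
    intro Y hY v
    have hd : DifferentiableAt ℝ h (‖Y‖⁻¹ • Y) := hh.differentiable two_ne_zero _
    obtain ⟨D, hD, hDv⟩ := hasFDerivAt_homogeneous (X := ℝ) (f := fun y => h y.1) (x := 0)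
      (hne hY) (hd.comp (‖Y‖⁻¹ • Y, (0 : ℝ)) differentiableAt_fst) (hχ1 Y hY)
    have h1 : HasFDerivAt g (D.comp (.inl ℝ E ℝ)) Y :=
      HasFDerivAt.comp Y (f := fun Y : E => (Y, (0 : ℝ))) hD (hasFDerivAt_prodMk_left Y 0)
    have h2 : HasFDerivAt (fun y : E × ℝ => h y.1) _ (‖Y‖⁻¹ • Y, (0 : ℝ)) :=
      HasFDerivAt.comp (‖Y‖⁻¹ • Y, (0 : ℝ)) hd.hasFDerivAt hasFDerivAt_fst
    rw [h1.fderiv, ContinuousLinearMap.comp_apply, ContinuousLinearMap.inl_apply, hDv, h2.fderiv]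
    simp
  have hK : ContDiff ℝ 2 K := by
    refine contDiff_mul_of_tsupport_subset (U := {y | y.1 ≠ 0}) (hχ2.comp contDiff_fst)
      ?_ fun y hy => ?_
    · refine (tsupport_comp_subset_preimage χ continuous_fst).trans fun y hy => hχU hy
    · exact ((hnormc _ hy).comp y contDiffAt_fst).mul (hκ.contDiffAt.comp y
        (((hinvc _ hy).comp y contDiffAt_fst).prodMk contDiffAt_snd))
  have hg : ContDiff ℝ 2 g := contDiff_mul_of_tsupport_subset hχ2 hχU fun Y hY =>
    (hnormc Y hY).mul (hh.contDiffAt.comp Y (hinvc Y hY))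
  have hgc : HasCompactSupport g := hχc.mul_right
  have hKc : HasCompactSupport K := by
    have hc : IsCompact (tsupport χ ×ˢ (Prod.snd '' tsupport κ)) :=
      IsCompact.prod hχc (hκc.image continuous_snd)
    refine HasCompactSupport.of_support_subset_isCompact hc fun y hy => ?_
    refine ⟨subset_tsupport _ (left_ne_zero_of_mul hy), ?_⟩
    exact ⟨_, subset_tsupport _ (right_ne_zero_of_mul (right_ne_zero_of_mul hy)), rfl⟩
  have hK0 : ∀ y, 0 ≤ K y := fun y =>
    mul_nonneg (hχ01 _).1 (mul_nonneg (norm_nonneg _) (hκ0 _))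
  have hKP : ∀ y : E × E × ℝ, ‖(hamVF K y).1‖ ≤ C * ‖y.1‖ := by
    rintro ⟨Y, p, t⟩
    have h1 : ∀ w : E, fderiv ℝ K (Y, p, t) (0, w, 0)
        = (χ Y * ‖Y‖) * fderiv ℝ κ (‖Y‖⁻¹ • Y, p, t) (0, w, 0) := by
      intro w
      have hl : ∀ n : E, HasDerivAt (fun a : ℝ => (n, p + a • w, t)) (0, w, 0) 0 := fun n =>
        (hasDerivAt_const _ _).prodMk
          ((by simpa using ((hasDerivAt_id (0 : ℝ)).smul_const w).const_add p :
            HasDerivAt (fun a : ℝ => p + a • w) w 0).prodMk (hasDerivAt_const _ _))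
      have h2 : HasDerivAt (fun a : ℝ => K (Y, p + a • w, t))
          (fderiv ℝ K (Y, p + (0 : ℝ) • w, t) (0, w, 0)) 0 :=
        HasFDerivAt.comp_hasDerivAt (l := K) (0 : ℝ)
          (hK.differentiable two_ne_zero _).hasFDerivAt (hl Y)
      have h3 : HasDerivAt (fun a : ℝ => κ (‖Y‖⁻¹ • Y, p + a • w, t))
          (fderiv ℝ κ (‖Y‖⁻¹ • Y, p + (0 : ℝ) • w, t) (0, w, 0)) 0 :=
        HasFDerivAt.comp_hasDerivAt (l := κ) (0 : ℝ)
          (hκ.differentiable two_ne_zero _).hasFDerivAt (hl _)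
      have h4 := h2.unique ((h3.const_mul (χ Y * ‖Y‖)).congr_of_eventuallyEq
        (Filter.Eventually.of_forall fun a => by simp only [hKdef]; ring))
      simpa using h4
    set u := (hamVF K (Y, p, t)).1 with hu
    have h2 : ‖u‖ ^ 2 ≤ (C * ‖Y‖) * ‖u‖ := by
      rw [← real_inner_self_eq_norm_sq, hu, inner_hamVF_fst, ← hu, h1]
      have h3 : |fderiv ℝ κ (‖Y‖⁻¹ • Y, p, t) (0, u, 0)| ≤ C * ‖u‖ := by
        rw [← Real.norm_eq_abs]
        refine (ContinuousLinearMap.le_opNorm _ _).trans ?_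
        have : ‖((0, u, 0) : E × E × ℝ)‖ = ‖u‖ := by simp [Prod.norm_def]
        rw [this]
        exact mul_le_mul_of_nonneg_right (hC _) (norm_nonneg _)
      refine (neg_le_abs _).trans ?_
      rw [abs_mul, abs_mul, abs_norm, abs_of_nonneg (hχ01 Y).1]
      calc χ Y * ‖Y‖ * _ ≤ 1 * ‖Y‖ * (C * ‖u‖) := by
            gcongr
            exact (hχ01 Y).2
        _ = _ := by ring
    rcases (norm_nonneg u).eq_or_lt with h0 | h0
    · rw [← h0]
      positivity
    · rw [pow_two] at h2
      exact le_of_mul_le_mul_right h2 h0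
  have hgval : g q₀ = h q₀ := by
    have : ‖q₀‖ ∈ I := by
      rw [hsph hq₀]
      exact ⟨Real.exp_le_one_iff.2 (by linarith), Real.one_le_exp (by linarith)⟩
    simp [hgdef, hsph hq₀, (hχ1 q₀ this).eq_of_nhds]
  rw [← hgval]
  refine exists_trajectory_of_cone hK hKc hK0 hg hgc hC0 hKP ?_ ?_ hqc hPc ?_ hq0 ?_
    (fun s hs => hq1 s hs 1 (right_mem_Icc.2 zero_le_one)) hq₀
  · rintro ⟨Y, x⟩ hY
    rw [show ((Y, x).1, (0 : E), (0 : ℝ)) = (Y, (0 : E × ℝ)) from rfl, hKder Y x hY,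
      (hunit (hne hY)).1, (hunit (hne hY)).2, smul_zero, Prod.mk_zero_zero, map_zero]
    simp [hKdef, (hχ1 Y hY).eq_of_nhds]
  · intro Y hY
    rw [hgder Y hY, (hunit (hne hY)).1, (hunit (hne hY)).2, map_zero]
    simp [hgdef, (hχ1 Y hY).eq_of_nhds]
  · intro s hs r hr t ht
    have hn := hscale hr (hq1 s hs t ht)
    have hr0 := (hpos hr).ne'
    have hKd := hKder (r • q s t) (P s t, t) (by rw [hn]; exact hr)
    rw [hn, inv_smul_smul₀ hr0] at hKd
    have : hamVF K (r • q s t, P s t, t) = (r • q' s t, P' s t) := by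
      refine Prod.ext (ext_inner_right ℝ fun w => ?_) (ext_inner_right ℝ fun w => ?_)
      · rw [inner_hamVF_fst, hKd]
        simp [hder s hs t ht, inner_smul_left, inner_smul_right]
      · rw [inner_hamVF_snd, show ((w, 0, 0) : E × E × ℝ) = (w, (0 : E × ℝ)) from rfl, hKd,
          hval s hs t ht, smul_zero, show (0 : E × ℝ) = (0, 0) from rfl, hder s hs t ht]
        rw [inner_sub_right, inner_smul_right, real_inner_comm (P' s t) (q s t), inner_zero_right]
        ring
    rw [this]
    exact ((hq s hs t ht).const_smul r).prodMk (hP s hs t ht)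
  · intro s hs r hr
    have hn := hscale hr (hsph hs)
    have hgd := hgder (r • s) (by rw [hn]; exact hr)
    rw [hn, inv_smul_smul₀ (hpos hr).ne'] at hgd
    refine ext_inner_right ℝ fun v => ?_
    rw [inner_gradient_left, hgd, hP0 s hs, ← inner_gradient_left]
    simp only [inner_add_left, inner_sub_left, inner_sub_right, real_inner_smul_left,
      real_inner_smul_right]
    ring

end Homogenization

/-! ### The contact Hamiltonian of a positive isotopy -/

section ContactHamiltonian

open Topology

/-- An injective immersion of a compact set into a vector space has a globally defined
`C^n` left inverse. -/
theorem exists_contDiff_leftInverse {X Y : Type*} [NormedAddCommGroup X] [NormedSpace ℝ X]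
    [FiniteDimensional ℝ X] [NormedAddCommGroup Y] [NormedSpace ℝ Y] [FiniteDimensional ℝ Y]
    {Φ : X → Y} {M : Set X} (hM : IsCompact M) {n : ℕ} (hn : n ≠ 0)
    (hΦ : ∀ x ∈ M, ContDiffAt ℝ n Φ x) (hinj : InjOn Φ M)
    (hker : ∀ x ∈ M, ∀ v, fderiv ℝ Φ x v = 0 → v = 0) :
    ∃ σ : Y → X, ContDiff ℝ n σ ∧ ∀ x ∈ M, σ (Φ x) = x := by
  have hc : ContinuousOn Φ M := fun x hx => (hΦ x hx).continuousAt.continuousWithinAt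
  have hn' : (n : WithTop ℕ∞) ≠ 0 := by exact_mod_cast hn
  suffices Hloc : ∀ y : Y, ∃ U ∈ 𝓝 y, ∃ g : Y → X,
      ContMDiffOn (modelWithCornersSelf ℝ Y) (modelWithCornersSelf ℝ X) n g U ∧
        ∀ z ∈ U, g z ∈ {a : X | ∀ x ∈ M, Φ x = z → a = x} by
    obtain ⟨g, hg⟩ := exists_contMDiffMap_forall_mem_convex_of_local (n := n)
      (modelWithCornersSelf ℝ Y) (t := fun y => {z : X | ∀ x ∈ M, Φ x = y → z = x})
      (fun y a ha b hb α β _ _ hαβ x hx hxy => by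
        rw [ha x hx hxy, hb x hx hxy, ← add_smul, hαβ, one_smul]) Hloc
    exact ⟨g, g.contMDiff.contDiff, fun x hx => hg _ x hx rfl⟩
  intro y
  by_cases hy : y ∈ Φ '' M
  · obtain ⟨a, ha, rfl⟩ := hy
    have hd : HasFDerivAt Φ (fderiv ℝ Φ a) a := ((hΦ a ha).differentiableAt hn').hasFDerivAt
    obtain ⟨A, hA⟩ := (fderiv ℝ Φ a : X →ₗ[ℝ] Y).exists_leftInverse_of_injective
      (LinearMap.ker_eq_bot'.2 (hker a ha))
    set A' : Y →L[ℝ] X := LinearMap.toContinuousLinearMap A with hA'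
    have hψ : ContDiffAt ℝ n (A' ∘ Φ) a := A'.contDiff.contDiffAt.comp a (hΦ a ha)
    have hψd : HasFDerivAt (A' ∘ Φ) (ContinuousLinearEquiv.refl ℝ X : X →L[ℝ] X) a := by
      refine (A'.hasFDerivAt.comp a hd).congr_fderiv (ContinuousLinearMap.ext fun v => ?_)
      exact LinearMap.congr_fun hA v
    set e := hψ.toOpenPartialHomeomorph (A' ∘ Φ) hψd hn' with he
    have hea : a ∈ e.source := hψ.mem_toOpenPartialHomeomorph_source hψd hn'
    have hsymm : ContDiffAt ℝ n (fun y => e.symm (A' y)) (Φ a) :=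
      ContDiffAt.comp (Φ a) (g := e.symm) (hψ.to_localInverse hψd hn') A'.contDiff.contDiffAt
    have hfar : IsCompact (Φ '' (M \ e.source)) :=
      (hM.diff e.open_source).image_of_continuousOn (hc.mono sdiff_subset)
    have hnear : (Φ '' (M \ e.source))ᶜ ∈ 𝓝 (Φ a) :=
      hfar.isClosed.isOpen_compl.mem_nhds (by
        rintro ⟨x, hx, hxa⟩
        exact hx.2 (hinj hx.1 ha hxa ▸ hea))
    refine ⟨_, Filter.inter_mem hnear (hsymm.eventually (by simp)), fun y => e.symm (A' y),
      fun z hz => (show ContDiffAt ℝ n (fun y => e.symm (A' y)) z from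
        hz.2).contMDiffAt.contMDiffWithinAt, ?_⟩
    rintro _ ⟨hz, -⟩ x hx rfl
    have hxs : x ∈ e.source := by
      by_contra hxs
      exact hz ⟨x, ⟨hx, hxs⟩, rfl⟩
    exact e.left_inv hxs
  · refine ⟨_, (hM.image_of_continuousOn hc).isClosed.isOpen_compl.mem_nhds hy, fun _ => 0,
      contMDiffOn_const, ?_⟩
    rintro _ hz x hx rfl
    exact absurd ⟨x, hx, rfl⟩ hz

variable {E : Type*} [NormedAddCommGroup E] [InnerProductSpace ℝ E]

/-- Differentiating the Legendrian condition `⟪q, ∂P/∂v⟫ = 0` in time. -/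
theorem inner_fderiv_time_fderiv {q P : E × ℝ → E} {s : E} {t : ℝ} (ht : t ∈ Icc (0 : ℝ) 1)
    (hq : DifferentiableAt ℝ q (s, t)) (hP : ContDiffAt ℝ 2 P (s, t)) {v : E}
    (hleg : ∀ τ ∈ Icc (0 : ℝ) 1, ⟪q (s, τ), fderiv ℝ P (s, τ) (v, 0)⟫ = 0) :
    ⟪q (s, t), fderiv ℝ (fun x => fderiv ℝ P x (0, 1)) (s, t) (v, 0)⟫
      = -⟪fderiv ℝ q (s, t) (0, 1), fderiv ℝ P (s, t) (v, 0)⟫ := by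
  have hdP : HasFDerivAt (fderiv ℝ P) (fderiv ℝ (fderiv ℝ P) (s, t)) (s, t) :=
    ((hP.fderiv_right (m := 1) le_rfl).differentiableAt one_ne_zero).hasFDerivAt
  have happ : ∀ w : E × ℝ, HasFDerivAt (fun x => fderiv ℝ P x w)
      ((ContinuousLinearMap.apply ℝ E w).comp (fderiv ℝ (fderiv ℝ P) (s, t))) (s, t) := fun w =>
    HasFDerivAt.comp (s, t) (g := ContinuousLinearMap.apply ℝ E w)
      (ContinuousLinearMap.apply ℝ E w).hasFDerivAt hdP
  have hline : HasDerivAt (fun τ : ℝ => (s, τ)) ((0, 1) : E × ℝ) t :=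
    (hasDerivAt_const t s).prodMk (hasDerivAt_id t)
  have h1 : HasDerivAt (fun τ => q (s, τ)) (fderiv ℝ q (s, t) (0, 1)) t :=
    HasFDerivAt.comp_hasDerivAt (l := q) t hq.hasFDerivAt hline
  have h2 : HasDerivAt (fun τ => fderiv ℝ P (s, τ) (v, 0))
      (((ContinuousLinearMap.apply ℝ E (v, 0)).comp (fderiv ℝ (fderiv ℝ P) (s, t))) (0, 1)) t :=
    HasFDerivAt.comp_hasDerivAt (l := fun x => fderiv ℝ P x (v, 0)) t (happ (v, 0)) hline
  have h3 := (h1.inner ℝ h2).hasDerivWithinAt (s := Icc (0 : ℝ) 1)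
  simp only [ContinuousLinearMap.comp_apply, ContinuousLinearMap.apply_apply] at h3
  have h4 : HasDerivWithinAt (fun τ => ⟪q (s, τ), fderiv ℝ P (s, τ) (v, 0)⟫) 0 (Icc (0 : ℝ) 1) t :=
    (hasDerivWithinAt_const t _ (0 : ℝ)).congr (fun τ hτ => hleg τ hτ) (hleg t ht)
  have h5 := (uniqueDiffOn_Icc zero_lt_one t ht).eq_deriv _ h3 h4
  have hsymm := (hP.isSymmSndFDerivAt (by simp)).eq (0, 1) (v, 0)
  rw [(happ (0, 1)).fderiv]
  change ⟪q (s, t), fderiv ℝ (fderiv ℝ P) (s, t) (v, 0) (0, 1)⟫ = _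
  rw [← hsymm]
  linarith

/-- The Hamiltonian attached to the family `(q, P)` and to a parameterisation `ρ` of its
image. -/
def pulledHamiltonian (q P : E × ℝ → E) (ρ : E × E × ℝ → E × ℝ) (y : E × E × ℝ) : ℝ :=
  ⟪y.1, fderiv ℝ P (ρ y) (0, 1)⟫ - ⟪fderiv ℝ q (ρ y) (0, 1), y.2.1 - P (ρ y)⟫

theorem contDiffAt_pulledHamiltonian {q P : E × ℝ → E} {ρ : E × E × ℝ → E × ℝ}
    {y : E × E × ℝ} (hq : ContDiffAt ℝ 3 q (ρ y)) (hP : ContDiffAt ℝ 3 P (ρ y))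
    (hρ : ContDiffAt ℝ 2 ρ y) : ContDiffAt ℝ 2 (pulledHamiltonian q P ρ) y := by
  have h : ∀ f : E × ℝ → E, ContDiffAt ℝ 3 f (ρ y) →
      ContDiffAt ℝ 2 (fun y => fderiv ℝ f (ρ y) (0, 1)) y := fun f hf =>
    ((hf.fderiv_right (m := 2) (by norm_num)).comp y hρ).clm_apply contDiffAt_const
  exact (contDiffAt_fst.inner ℝ (h P hP)).sub ((h q hq).inner ℝ
    ((contDiffAt_fst.comp y contDiffAt_snd).sub ((hP.of_le (by norm_num)).comp y hρ)))

theorem fderiv_pulledHamiltonian {q P : E × ℝ → E} {ρ : E × E × ℝ → E × ℝ} {s : E} {t : ℝ}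
    (ht : t ∈ Icc (0 : ℝ) 1) (hq : ContDiffAt ℝ 2 q (s, t)) (hP : ContDiffAt ℝ 2 P (s, t))
    (hleg : ∀ v : E, ∀ τ ∈ Icc (0 : ℝ) 1, ⟪q (s, τ), fderiv ℝ P (s, τ) (v, 0)⟫ = 0)
    (hρ : DifferentiableAt ℝ ρ (q (s, t), P (s, t), t)) (hρt : ∀ y, (ρ y).2 = y.2.2)
    (hρs : ρ (q (s, t), P (s, t), t) = (s, t)) (w z : E) :
    fderiv ℝ (pulledHamiltonian q P ρ) (q (s, t), P (s, t), t) (w, z, 0)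
      = ⟪fderiv ℝ P (s, t) (0, 1), w⟫ - ⟪fderiv ℝ q (s, t) (0, 1), z⟫ := by
  obtain ⟨y, hy⟩ : ∃ y, y = (q (s, t), P (s, t), t) := ⟨_, rfl⟩
  rw [← hy] at hρ hρs ⊢
  have hdt : ∀ f : E × ℝ → E, ContDiffAt ℝ 2 f (s, t) →
      HasFDerivAt (fun y => fderiv ℝ f (ρ y) (0, 1))
        ((fderiv ℝ (fun x => fderiv ℝ f x (0, 1)) (s, t)).comp (fderiv ℝ ρ y)) y := fun f hf =>
    HasFDerivAt.comp y (g := fun x => fderiv ℝ f x (0, 1)) (by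
      rw [hρs]
      exact ((((hf.fderiv_right (m := 1) le_rfl).clm_apply contDiffAt_const)).differentiableAt
        one_ne_zero).hasFDerivAt) hρ.hasFDerivAt
  have hdP : HasFDerivAt (fun y => P (ρ y)) ((fderiv ℝ P (s, t)).comp (fderiv ℝ ρ y)) y :=
    HasFDerivAt.comp y (g := P) (by
      rw [hρs]
      exact (hP.differentiableAt two_ne_zero).hasFDerivAt) hρ.hasFDerivAt
  have h1 : HasFDerivAt (fun y : E × E × ℝ => y.1) (.fst ℝ E (E × ℝ)) y := hasFDerivAt_fst
  have h2 : HasFDerivAt (fun y : E × E × ℝ => y.2.1)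
      ((ContinuousLinearMap.fst ℝ E ℝ).comp (.snd ℝ E (E × ℝ))) y :=
    HasFDerivAt.comp y (g := Prod.fst) hasFDerivAt_fst hasFDerivAt_snd
  have h22 : HasFDerivAt (fun y : E × E × ℝ => y.2.2)
      ((ContinuousLinearMap.snd ℝ E ℝ).comp (.snd ℝ E (E × ℝ))) y :=
    HasFDerivAt.comp y (g := Prod.snd) hasFDerivAt_snd hasFDerivAt_snd
  have h3 : HasFDerivAt (pulledHamiltonian q P ρ) _ y :=
    (h1.inner ℝ (hdt P hP)).sub ((hdt q hq).inner ℝ (h2.sub hdP))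
  have hρ0 : (fderiv ℝ ρ y (w, z, 0)).2 = 0 := by
    have h4 : HasFDerivAt (fun y => (ρ y).2)
        ((ContinuousLinearMap.snd ℝ E ℝ).comp (fderiv ℝ ρ y)) y :=
      HasFDerivAt.comp y (g := Prod.snd) hasFDerivAt_snd hρ.hasFDerivAt
    simp only [hρt] at h4
    exact congrArg (fun L : E × E × ℝ →L[ℝ] ℝ => L (w, z, 0)) (h4.unique h22)
  obtain ⟨v, hv⟩ : ∃ v, fderiv ℝ ρ y (w, z, 0) = (v, 0) := ⟨_, Prod.ext rfl hρ0⟩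
  have h5 := inner_fderiv_time_fderiv ht (hq.differentiableAt two_ne_zero) hP (hleg v)
  rw [h3.fderiv]
  simp [hv, hρs, real_inner_comm w, inner_sub_right]
  simp only [hy, h5]
  ring

end ContactHamiltonian

/-! ### Positive isotopies -/

section PositiveIsotopy

open Topology

variable {E : Type*} [NormedAddCommGroup E] [InnerProductSpace ℝ E]

theorem inner_fderiv_eq_zero_of_norm_eq_one {q : E × ℝ → E} {s : E} {t : ℝ} (hs : s ≠ 0)
    (hq : DifferentiableAt ℝ q (s, t)) (hq1 : ∀ s, s ≠ 0 → ‖q (s, t)‖ = 1) (v : E) :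
    ⟪q (s, t), fderiv ℝ q (s, t) (v, 0)⟫ = 0 := by
  have h1 : HasFDerivAt (fun s => q (s, t)) ((fderiv ℝ q (s, t)).comp (.inl ℝ E ℝ)) s :=
    HasFDerivAt.comp s (g := q) hq.hasFDerivAt (hasFDerivAt_prodMk_left s t)
  have h2 := h1.inner ℝ h1
  have h3 : HasFDerivAt (fun s => ⟪q (s, t), q (s, t)⟫) (0 : E →L[ℝ] ℝ) s := by
    refine (hasFDerivAt_const (1 : ℝ) s).congr_of_eventuallyEq ?_
    filter_upwards [isOpen_ne.mem_nhds hs] with x hx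
    rw [real_inner_self_eq_norm_sq, hq1 x hx, one_pow]
  have h4 := congrArg (fun L : E →L[ℝ] ℝ => L v) (h2.unique h3)
  simp [real_inner_comm (q (s, t))] at h4
  exact h4

/-- The cone over an embedded family is an embedded family. -/
theorem eq_zero_of_fderiv_cone {q P : E × ℝ → E} {s : E} {t : ℝ} (hs : s ∈ sphere (0 : E) 1)
    (hq : DifferentiableAt ℝ q (s, t)) (hP : DifferentiableAt ℝ P (s, t))
    (hq1 : ∀ s, s ≠ 0 → ‖q (s, t)‖ = 1)
    (himm : ∀ v : E, ⟪v, s⟫ = 0 → fderiv ℝ q (s, t) (v, 0) = 0 →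
      fderiv ℝ P (s, t) (v, 0) = 0 → v = 0) {v : E × ℝ}
    (hv : fderiv ℝ (fun x : E × ℝ => (‖x.1‖ • q x, P x, x.2)) (s, t) v = 0) : v = 0 := by
  have hs1 : ‖s‖ = 1 := by simpa using hs
  have hs0 : s ≠ 0 := norm_ne_zero_iff.1 (by rw [hs1]; exact one_ne_zero)
  have hn : HasFDerivAt (fun x : E × ℝ => ‖x.1‖)
      ((innerSL ℝ (‖s‖⁻¹ • s)).comp (.fst ℝ E ℝ)) (s, t) :=
    HasFDerivAt.comp (s, t) (g := fun x : E => ‖x‖) (hasFDerivAt_norm_inner hs0) hasFDerivAt_fst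
  have h1 : HasFDerivAt (fun x : E × ℝ => (‖x.1‖ • q x, P x, x.2)) _ (s, t) :=
    (hn.smul hq.hasFDerivAt).prodMk (hP.hasFDerivAt.prodMk hasFDerivAt_snd)
  obtain ⟨v, a⟩ := v
  rw [h1.fderiv] at hv
  simp [hs1] at hv
  obtain ⟨h2, h3, rfl⟩ := hv
  have h4 : ⟪s, v⟫ = 0 := by
    have := congrArg (fun z => ⟪q (s, t), z⟫) h2
    simpa [inner_add_right, inner_smul_right, hq1 s hs0,
      inner_fderiv_eq_zero_of_norm_eq_one hs0 hq hq1 v] using this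
  rw [h4, zero_smul, add_zero] at h2
  rw [himm v (by rw [real_inner_comm, h4]) h2 h3]
  rfl

variable [FiniteDimensional ℝ E]

/-- Every fibre of a positive isotopy starting at the graph of `h` is reached above the
graph of `h`. -/
theorem exists_le_of_positive_isotopy {q P : E × ℝ → E}
    (hq : ∀ s : E, s ≠ 0 → ∀ t, ContDiffAt ℝ 3 q (s, t))
    (hP : ∀ s : E, s ≠ 0 → ∀ t, ContDiffAt ℝ 3 P (s, t))
    (hq1 : ∀ s : E, s ≠ 0 → ∀ t ∈ Icc (0 : ℝ) 1, ‖q (s, t)‖ = 1)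
    (hleg : ∀ s ∈ sphere (0 : E) 1, ∀ v : E, ∀ t ∈ Icc (0 : ℝ) 1,
      ⟪q (s, t), fderiv ℝ P (s, t) (v, 0)⟫ = 0)
    (hinj : ∀ t ∈ Icc (0 : ℝ) 1, InjOn (fun s => (q (s, t), P (s, t))) (sphere 0 1))
    (himm : ∀ s ∈ sphere (0 : E) 1, ∀ t ∈ Icc (0 : ℝ) 1, ∀ v : E, ⟪v, s⟫ = 0 →
      fderiv ℝ q (s, t) (v, 0) = 0 → fderiv ℝ P (s, t) (v, 0) = 0 → v = 0)
    (hpos : ∀ s ∈ sphere (0 : E) 1, ∀ t ∈ Icc (0 : ℝ) 1,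
      0 < ⟪q (s, t), fderiv ℝ P (s, t) (0, 1)⟫)
    {h : E → ℝ} (hh : ContDiff ℝ 2 h) (hq0 : ∀ s ∈ sphere (0 : E) 1, q (s, 0) = s)
    (hP0 : ∀ s ∈ sphere (0 : E) 1,
      P (s, 0) = h s • s + (gradient h s - ⟪gradient h s, s⟫ • s))
    {q₀ : E} (hq₀ : q₀ ∈ sphere (0 : E) 1) :
    ∃ s ∈ sphere (0 : E) 1, q (s, 1) = q₀ ∧ h q₀ ≤ ⟪P (s, 1), q₀⟫ := by
  have hs1 : ∀ {s : E}, s ∈ sphere (0 : E) 1 → ‖s‖ = 1 := fun hs => by simpa using hs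
  have hs0 : ∀ {s : E}, s ∈ sphere (0 : E) 1 → s ≠ 0 := fun hs =>
    norm_ne_zero_iff.1 (by rw [hs1 hs]; exact one_ne_zero)
  have h23 : (2 : WithTop ℕ∞) ≤ 3 := by norm_num
  set Γ : E × ℝ → E × E × ℝ := fun x => (‖x.1‖ • q x, P x, x.2) with hΓ
  set M : Set (E × ℝ) := sphere (0 : E) 1 ×ˢ Icc (0 : ℝ) 1 with hM
  have hMc : IsCompact M := (isCompact_sphere _ _).prod isCompact_Icc
  have hΓ2 : ∀ x ∈ M, ContDiffAt ℝ 2 Γ x := fun x hx =>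
    (((contDiffAt_norm ℝ (hs0 hx.1)).comp x contDiffAt_fst).smul
      ((hq x.1 (hs0 hx.1) x.2).of_le h23)).prodMk
      (((hP x.1 (hs0 hx.1) x.2).of_le h23).prodMk contDiffAt_snd)
  have hΓM : ∀ s ∈ sphere (0 : E) 1, ∀ t, Γ (s, t) = (q (s, t), P (s, t), t) := fun s hs t => by
    simp [hΓ, hs1 hs]
  obtain ⟨σ, hσ, hσΓ⟩ := exists_contDiff_leftInverse (n := 2) hMc two_ne_zero hΓ2
    (by
      rintro ⟨s, t⟩ ⟨hs, ht⟩ ⟨s', t'⟩ ⟨hs', ht'⟩ heq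
      rw [hΓM s hs, hΓM s' hs'] at heq
      simp only [Prod.mk.injEq] at heq
      obtain ⟨h1, h2, rfl⟩ := heq
      exact congrArg (·, t) (hinj t ht hs hs' (Prod.ext h1 h2)))
    (fun x hx v hv => eq_zero_of_fderiv_cone hx.1
      ((hq x.1 (hs0 hx.1) x.2).differentiableAt (by norm_num))
      ((hP x.1 (hs0 hx.1) x.2).differentiableAt (by norm_num))
      (fun s hs => hq1 s hs x.2 hx.2) (himm x.1 hx.1 x.2 hx.2) hv)
  set ρ : E × E × ℝ → E × ℝ := fun y => ((σ y).1, y.2.2) with hρdef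
  have hρ : ContDiff ℝ 2 ρ :=
    (contDiff_fst.comp hσ).prodMk (contDiff_snd.comp contDiff_snd)
  have hρΓ : ∀ s ∈ sphere (0 : E) 1, ∀ t ∈ Icc (0 : ℝ) 1,
      ρ (q (s, t), P (s, t), t) = (s, t) := fun s hs t ht => by
    have h1 := hσΓ (s, t) ⟨hs, ht⟩
    rw [hΓM s hs] at h1
    simp [hρdef, h1]
  set k := pulledHamiltonian q P ρ with hk
  have hk2 : ∀ y, (ρ y).1 ≠ 0 → ContDiffAt ℝ 2 k y := fun y hy =>
    contDiffAt_pulledHamiltonian (hq _ hy _) (hP _ hy _) hρ.contDiffAt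
  have hkval : ∀ s ∈ sphere (0 : E) 1, ∀ t ∈ Icc (0 : ℝ) 1,
      k (q (s, t), P (s, t), t) = ⟪q (s, t), fderiv ℝ P (s, t) (0, 1)⟫ := fun s hs t ht => by
    simp [hk, pulledHamiltonian, hρΓ s hs t ht]
  have hWo : IsOpen {y | (ρ y).1 ≠ 0} := isOpen_ne.preimage (continuous_fst.comp hρ.continuous)
  obtain ⟨χ, hχ, hχc, hχU, hχ01, hχ1⟩ := exists_smooth_cutoff
    (hMc.image_of_continuousOn fun x hx => (hΓ2 x hx).continuousAt.continuousWithinAt)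
    (ContinuousOn.isOpen_inter_preimage (f := k)
      (fun y hy => (hk2 y hy).continuousAt.continuousWithinAt) hWo (isOpen_Ioi (a := 0)))
    (by
      rintro _ ⟨⟨s, t⟩, ⟨hs, ht⟩, rfl⟩
      rw [hΓM s hs]
      refine ⟨?_, ?_⟩
      · change (ρ _).1 ≠ 0
        rw [hρΓ s hs t ht]
        exact hs0 hs
      · change 0 < k _
        rw [hkval s hs t ht]
        exact hpos s hs t ht)
  have hnear : ∀ s ∈ sphere (0 : E) 1, ∀ t ∈ Icc (0 : ℝ) 1,
      (fun y => χ y * k y) =ᶠ[𝓝 (q (s, t), P (s, t), t)] k := fun s hs t ht => by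
    rw [← hΓM s hs]
    filter_upwards [hχ1 _ ⟨(s, t), ⟨hs, ht⟩, rfl⟩] with y hy
    simp [hy]
  have hslice : ∀ f : E × ℝ → E, (∀ s : E, s ≠ 0 → ∀ t, ContDiffAt ℝ 3 f (s, t)) →
      ContinuousOn (fun s => f (s, 1)) (sphere 0 1) ∧ ∀ s ∈ sphere (0 : E) 1,
        ∀ t ∈ Icc (0 : ℝ) 1, HasDerivAt (fun t => f (s, t)) (fderiv ℝ f (s, t) (0, 1)) t := by
    refine fun f hf => ⟨fun s hs => ?_, fun s hs t _ => ?_⟩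
    · exact (ContinuousAt.comp (f := fun s => (s, (1 : ℝ))) (hf s (hs0 hs) 1).continuousAt
        (Continuous.prodMk_left (1 : ℝ)).continuousAt).continuousWithinAt
    · exact HasFDerivAt.comp_hasDerivAt (l := f) t
        ((hf s (hs0 hs) t).differentiableAt (by norm_num)).hasFDerivAt
        ((hasDerivAt_const t s).prodMk (hasDerivAt_id t))
  refine exists_trajectory_of_contactHamiltonian (κ := fun y => χ y * k y)
    (q := fun s t => q (s, t)) (P := fun s t => P (s, t))
    (contDiff_mul_of_tsupport_subset (by simpa using contDiff_infty.1 hχ 2) hχU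
      fun y hy => hk2 y hy.1)
    hχc.mul_right (fun y => ?_) hh (hslice q hq).1 (hslice P hP).1 (hslice q hq).2 (hslice P hP).2
    (fun s hs => hq1 s (hs0 hs)) (fun s hs t ht => ?_) (fun s hs t ht w z => ?_) hq0 hP0 hq₀
  · by_cases hy : y ∈ tsupport χ
    · exact mul_nonneg (hχ01 y).1 (le_of_lt (hχU hy).2)
    · simp [image_eq_zero_of_notMem_tsupport hy]
  · rw [← hkval s hs t ht]
    exact (hnear s hs t ht).eq_of_nhds
  · rw [(hnear s hs t ht).fderiv_eq]
    exact fderiv_pulledHamiltonian ht ((hq s (hs0 hs) t).of_le h23) ((hP s (hs0 hs) t).of_le h23)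
      (hleg s hs) (hρ.differentiable two_ne_zero _) (fun _ => rfl) (hρΓ s hs t ht) w z

end PositiveIsotopy

/-! ### Front coordinates of a Legendrian isotopy -/

section FrontCoordinates

open Topology

variable {E : Type*} [NormedAddCommGroup E] [InnerProductSpace ℝ E]

theorem inner_fderiv_add_eq_zero {A B : E × ℝ → E} {s : E} {t : ℝ} (hs : s ≠ 0)
    (ht : t ∈ Icc (0 : ℝ) 1) (hA : DifferentiableAt ℝ A (s, t))
    (hB : DifferentiableAt ℝ B (s, t)) {c : ℝ}
    (h : ∀ s, s ≠ 0 → ∀ t ∈ Icc (0 : ℝ) 1, ⟪A (s, t), B (s, t)⟫ = c) (w : E × ℝ) :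
    ⟪A (s, t), fderiv ℝ B (s, t) w⟫ + ⟪fderiv ℝ A (s, t) w, B (s, t)⟫ = 0 := by
  have h1 := (hA.hasFDerivAt.inner ℝ hB.hasFDerivAt).hasFDerivWithinAt
    (s := {0}ᶜ ×ˢ Icc (0 : ℝ) 1)
  have h2 : HasFDerivWithinAt (fun x => ⟪A x, B x⟫) (0 : E × ℝ →L[ℝ] ℝ)
      ({0}ᶜ ×ˢ Icc (0 : ℝ) 1) (s, t) :=
    (hasFDerivWithinAt_const c _ _).congr (fun x hx => h x.1 hx.1 x.2 hx.2) (h s hs t ht)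
  have hu : UniqueDiffWithinAt ℝ ({0}ᶜ ×ˢ Icc (0 : ℝ) 1) (s, t) :=
    (isOpen_compl_singleton.uniqueDiffWithinAt hs).prod (uniqueDiffOn_Icc zero_lt_one t ht)
  have h3 := congrArg (fun L : E × ℝ →L[ℝ] ℝ => L w) (hu.eq h1 h2)
  simpa using h3

theorem fderiv_add_smul_apply {p q : E × ℝ → E} {u : E × ℝ → ℝ} {x : E × ℝ}
    (hp : DifferentiableAt ℝ p x) (hq : DifferentiableAt ℝ q x) (hu : DifferentiableAt ℝ u x)
    (w : E × ℝ) : fderiv ℝ (fun x => p x + u x • q x) x w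
      = fderiv ℝ p x w + (u x • fderiv ℝ q x w + fderiv ℝ u x w • q x) := by
  have h : HasFDerivAt (fun x => p x + u x • q x) _ x :=
    hp.hasFDerivAt.add (hu.hasFDerivAt.smul hq.hasFDerivAt)
  rw [h.fderiv]
  simp

/-- The contact form evaluated through the coordinates `(q, p + u q)`. -/
theorem inner_fderiv_add_smul {p q : E × ℝ → E} {u : E × ℝ → ℝ} {s : E} {t : ℝ} (hs : s ≠ 0)
    (ht : t ∈ Icc (0 : ℝ) 1) (hp : DifferentiableAt ℝ p (s, t))
    (hq : DifferentiableAt ℝ q (s, t)) (hu : DifferentiableAt ℝ u (s, t))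
    (hq1 : ∀ s, s ≠ 0 → ∀ t ∈ Icc (0 : ℝ) 1, ‖q (s, t)‖ = 1)
    (hpq : ∀ s, s ≠ 0 → ∀ t ∈ Icc (0 : ℝ) 1, ⟪p (s, t), q (s, t)⟫ = 0) (w : E × ℝ) :
    ⟪q (s, t), fderiv ℝ (fun x => p x + u x • q x) (s, t) w⟫
      = fderiv ℝ u (s, t) w - ⟪p (s, t), fderiv ℝ q (s, t) w⟫ := by
  have h1 := inner_fderiv_add_eq_zero hs ht hq hq (c := 1)
    (fun s hs t ht => by rw [real_inner_self_eq_norm_sq, hq1 s hs t ht, one_pow]) w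
  have h2 := inner_fderiv_add_eq_zero hs ht hp hq hpq w
  rw [real_inner_comm (q (s, t))] at h1 h2
  rw [fderiv_add_smul_apply hp hq hu, inner_add_right, inner_add_right, inner_smul_right,
    inner_smul_right, real_inner_self_eq_norm_sq, hq1 s hs t ht]
  have h3 : ⟪q (s, t), fderiv ℝ q (s, t) w⟫ = 0 := by linarith
  rw [h3]
  linarith

end FrontCoordinates

/-! ### Legendrian isotopies in the jet space of the sphere -/

section JetIsotopy

open Topology

variable {m : ℕ} {F : EuclideanSpace ℝ (Fin m) × ℝ → JetSp m}

/-- The extension of a family over the sphere which is homogeneous of degree zero. -/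
def radialExt (F : EuclideanSpace ℝ (Fin m) × ℝ → JetSp m)
    (x : EuclideanSpace ℝ (Fin m) × ℝ) : JetSp m :=
  F (‖x.1‖⁻¹ • x.1, x.2)

theorem radialExt_apply {s : EuclideanSpace ℝ (Fin m)} (hs : ‖s‖ = 1) (t : ℝ) :
    radialExt F (s, t) = F (s, t) := by
  simp [radialExt, hs]

theorem contDiffAt_radialExt {n : WithTop ℕ∞} (hF : ContDiff ℝ n F)
    {s : EuclideanSpace ℝ (Fin m)} (hs : s ≠ 0) (t : ℝ) :
    ContDiffAt ℝ n (radialExt F) (s, t) :=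
  hF.contDiffAt.comp (s, t) (((((contDiffAt_norm ℝ hs).inv (norm_ne_zero_iff.2 hs)).smul
    contDiffAt_id).comp (s, t) contDiffAt_fst).prodMk contDiffAt_snd)

theorem fderiv_radialExt {s : EuclideanSpace ℝ (Fin m)} (hs : ‖s‖ = 1) (t : ℝ)
    (hF : DifferentiableAt ℝ F (s, t)) (v : EuclideanSpace ℝ (Fin m)) (a : ℝ) :
    fderiv ℝ (radialExt F) (s, t) (v, a) = fderiv ℝ F (s, t) (v - ⟪s, v⟫ • s, a) := by
  have hs0 : s ≠ 0 := norm_ne_zero_iff.1 (by rw [hs]; exact one_ne_zero)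
  have h1 : HasFDerivAt (fun x : EuclideanSpace ℝ (Fin m) × ℝ => (‖x.1‖⁻¹ • x.1, x.2)) _ (s, t) :=
    (HasFDerivAt.comp (s, t) (hasFDerivAt_normalize hs0) hasFDerivAt_fst).prodMk hasFDerivAt_snd
  have h2 : HasFDerivAt (radialExt F) _ (s, t) := HasFDerivAt.comp (s, t) (g := F) (by
    have : (‖(s, t).1‖⁻¹ • (s, t).1, (s, t).2) = (s, t) := by simp [hs]
    rw [this]
    exact hF.hasFDerivAt) h1
  rw [h2.fderiv]
  simp [hs]

theorem fderiv_slice {s : EuclideanSpace ℝ (Fin m)} {t : ℝ} (hF : DifferentiableAt ℝ F (s, t))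
    (v : EuclideanSpace ℝ (Fin m)) :
    fderiv ℝ (fun s' => F (s', t)) s v = fderiv ℝ F (s, t) (v, 0) := by
  have h : HasFDerivAt (fun s' => F (s', t)) _ s :=
    HasFDerivAt.comp s (g := F) hF.hasFDerivAt (hasFDerivAt_prodMk_left s t)
  rw [h.fderiv]
  simp

theorem hasDerivAt_slice {s : EuclideanSpace ℝ (Fin m)} {t : ℝ}
    (hF : DifferentiableAt ℝ F (s, t)) :
    HasDerivAt (fun t' => F (s, t')) (fderiv ℝ F (s, t) (0, 1)) t :=
  HasFDerivAt.comp_hasDerivAt (l := F) t hF.hasFDerivAt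
    ((hasDerivAt_const t s).prodMk (hasDerivAt_id t))

theorem exists_le_add_of_nonneg {h : EuclideanSpace ℝ (Fin m) → ℝ}
    (hh : ContDiff ℝ (⊤ : ℕ∞) h) (hF : IsLegIsotopyJet m F) (hnn : NonnegJet m F)
    (hF0 : ∀ s ∈ sph m, F (s, 0) = (s, sphGrad m h s, h s)) {ε : ℝ} (hε : 0 < ε)
    {q₀ : EuclideanSpace ℝ (Fin m)} (hq₀ : q₀ ∈ sph m) :
    ∃ s ∈ sph m, (F (s, 1)).1 = q₀ ∧ h q₀ ≤ (F (s, 1)).2.2 + ε := by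
  have hs1 : ∀ {s}, s ∈ sph m → ‖s‖ = 1 := fun hs => by simpa [sph] using hs
  have hs0 : ∀ {s}, s ∈ sph m → s ≠ 0 := fun hs =>
    norm_ne_zero_iff.1 (by rw [hs1 hs]; exact one_ne_zero)
  have hnorm : ∀ {s : EuclideanSpace ℝ (Fin m)}, s ≠ 0 → ‖s‖⁻¹ • s ∈ sph m := fun {s} hs => by
    simp [sph, norm_smul, norm_ne_zero_iff.2 hs]
  have hF3 : ContDiff ℝ 3 F := by simpa using contDiff_infty.1 hF.smooth 3
  have hFd : ∀ x, DifferentiableAt ℝ F x := fun x => hF3.differentiable (by norm_num) x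
  have hG : ∀ s : EuclideanSpace ℝ (Fin m), s ≠ 0 → ∀ t, ContDiffAt ℝ 3 (radialExt F) (s, t) :=
    fun s hs t => contDiffAt_radialExt hF3 hs t
  set q : EuclideanSpace ℝ (Fin m) × ℝ → EuclideanSpace ℝ (Fin m) :=
    fun x => (radialExt F x).1 with hqdef
  set p : EuclideanSpace ℝ (Fin m) × ℝ → EuclideanSpace ℝ (Fin m) :=
    fun x => (radialExt F x).2.1 with hpdef
  set u : EuclideanSpace ℝ (Fin m) × ℝ → ℝ := fun x => (radialExt F x).2.2 + ε * x.2 with hudef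
  have hq : ∀ s, s ≠ 0 → ∀ t, ContDiffAt ℝ 3 q (s, t) := fun s hs t =>
    contDiffAt_fst.comp _ (hG s hs t)
  have hp : ∀ s, s ≠ 0 → ∀ t, ContDiffAt ℝ 3 p (s, t) := fun s hs t =>
    contDiffAt_fst.comp _ (contDiffAt_snd.comp _ (hG s hs t))
  have hu : ∀ s, s ≠ 0 → ∀ t, ContDiffAt ℝ 3 u (s, t) := fun s hs t =>
    (contDiffAt_snd.comp _ (contDiffAt_snd.comp _ (hG s hs t))).add
      (contDiffAt_const.mul contDiffAt_snd)
  have hd : ∀ s ∈ sph m, ∀ t w, fderiv ℝ q (s, t) w = (fderiv ℝ (radialExt F) (s, t) w).1 ∧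
      fderiv ℝ p (s, t) w = (fderiv ℝ (radialExt F) (s, t) w).2.1 ∧
      fderiv ℝ u (s, t) w = (fderiv ℝ (radialExt F) (s, t) w).2.2 + ε * w.2 := by
    intro s hs t w
    have h0 := ((hG s (hs0 hs) t).differentiableAt (by norm_num)).hasFDerivAt
    have h1 : HasFDerivAt q ((ContinuousLinearMap.fst ℝ _ _).comp _) (s, t) :=
      HasFDerivAt.comp (s, t) (g := Prod.fst) hasFDerivAt_fst h0
    have h2 : HasFDerivAt (fun x => (radialExt F x).2) ((ContinuousLinearMap.snd ℝ _ _).comp _)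
      (s, t) := HasFDerivAt.comp (s, t) (g := Prod.snd) hasFDerivAt_snd h0
    have h3 : HasFDerivAt p ((ContinuousLinearMap.fst ℝ _ _).comp _) (s, t) :=
      HasFDerivAt.comp (s, t) (g := Prod.fst) hasFDerivAt_fst h2
    have h4 : HasFDerivAt (fun x => (radialExt F x).2.2)
      ((ContinuousLinearMap.snd ℝ _ _).comp _) (s, t) :=
      HasFDerivAt.comp (s, t) (g := Prod.snd) hasFDerivAt_snd h2
    have h5 : HasFDerivAt u _ (s, t) := h4.add (hasFDerivAt_snd.const_mul ε)
    rw [h1.fderiv, h3.fderiv, h5.fderiv]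
    simp
  have hq1 : ∀ s, s ≠ 0 → ∀ t ∈ Icc (0 : ℝ) 1, ‖q (s, t)‖ = 1 := fun s hs t ht =>
    hs1 (hF.mem_sphere _ (hnorm hs) t ht)
  have hpq : ∀ s, s ≠ 0 → ∀ t ∈ Icc (0 : ℝ) 1, ⟪p (s, t), q (s, t)⟫ = 0 := fun s hs t ht =>
    hF.mem_jet _ (hnorm hs) t ht
  have hqP : ∀ s, s ≠ 0 → ∀ t ∈ Icc (0 : ℝ) 1,
      ⟪p (s, t) + u (s, t) • q (s, t), q (s, t)⟫ = u (s, t) := by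
    intro s hs t ht
    rw [inner_add_left, hpq s hs t ht, real_inner_smul_left, real_inner_self_eq_norm_sq,
      hq1 s hs t ht]
    ring
  have hmain : ∀ s ∈ sph m, ∀ t ∈ Icc (0 : ℝ) 1, ∀ w,
      ⟪q (s, t), fderiv ℝ (fun x => p x + u x • q x) (s, t) w⟫
        = fderiv ℝ u (s, t) w - ⟪p (s, t), fderiv ℝ q (s, t) w⟫ := fun s hs t ht =>
    inner_fderiv_add_smul (hs0 hs) ht ((hp s (hs0 hs) t).differentiableAt (by norm_num))
      ((hq s (hs0 hs) t).differentiableAt (by norm_num))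
      ((hu s (hs0 hs) t).differentiableAt (by norm_num)) hq1 hpq
  have hcontact : ∀ s ∈ sph m, ∀ t ∈ Icc (0 : ℝ) 1, ∀ v,
      fderiv ℝ u (s, t) (v, 0) = ⟪p (s, t), fderiv ℝ q (s, t) (v, 0)⟫ := by
    intro s hs t ht v
    rw [(hd s hs t _).1, (hd s hs t _).2.2, fderiv_radialExt (hs1 hs) t (hFd _),
      ← fderiv_slice (hFd _), mul_zero, add_zero, hF.leg t ht s hs _ ?_]
    · simp [hpdef, radialExt_apply (hs1 hs)]
    · rw [inner_sub_left, real_inner_smul_left, real_inner_self_eq_norm_sq, hs1 hs,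
        real_inner_comm]
      ring
  suffices key : ∃ s ∈ sph m, q (s, 1) = q₀ ∧ h q₀ ≤ ⟪p (s, 1) + u (s, 1) • q (s, 1), q₀⟫ by
    obtain ⟨s, hs, hsq, hle⟩ := key
    refine ⟨s, hs, by simpa [hqdef, radialExt_apply (hs1 hs)] using hsq, ?_⟩
    have h1 := hqP s (hs0 hs) 1 (right_mem_Icc.2 zero_le_one)
    rw [hsq] at h1 hle
    rw [h1] at hle
    simpa [hudef, radialExt_apply (hs1 hs)] using hle
  refine exists_le_of_positive_isotopy (q := q)
    (P := fun x => p x + u x • q x) hq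
    (fun s hs t => (hp s hs t).add ((hu s hs t).smul (hq s hs t))) hq1
    (fun s hs v t ht => by rw [hmain s hs t ht, hcontact s hs t ht, sub_self])
    (fun t ht s hs s' hs' heq => ?_) (fun s hs t ht v hv hqv hPv => ?_)
    (fun s hs t ht => ?_) (by simpa using contDiff_infty.1 hh 2) (fun s hs => ?_)
    (fun s hs => ?_) hq₀
  · simp only [Prod.mk.injEq] at heq
    obtain ⟨h1, h2⟩ := heq
    have h3 : u (s, t) = u (s', t) := by
      rw [← hqP s (hs0 hs) t ht, ← hqP s' (hs0 hs') t ht, h2, h1]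
    rw [h1, h3, add_left_inj] at h2
    refine hF.inj t ht hs hs' ?_
    simp only [hudef, add_left_inj] at h3
    simp only [hqdef, hpdef] at h1 h2
    rw [radialExt_apply (hs1 hs), radialExt_apply (hs1 hs')] at h1 h2 h3
    exact Prod.ext h1 (Prod.ext h2 h3)
  · have h1 := hcontact s hs t ht v
    rw [hqv, inner_zero_right] at h1
    rw [fderiv_add_smul_apply ((hp s (hs0 hs) t).differentiableAt (by norm_num))
      ((hq s (hs0 hs) t).differentiableAt (by norm_num))
      ((hu s (hs0 hs) t).differentiableAt (by norm_num)), hqv, h1, smul_zero, zero_smul, add_zero,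
      add_zero] at hPv
    rw [(hd s hs t _).1] at hqv
    rw [(hd s hs t _).2.1] at hPv
    rw [(hd s hs t _).2.2, mul_zero, add_zero] at h1
    have h2 : fderiv ℝ (radialExt F) (s, t) (v, 0) = 0 := Prod.ext hqv (Prod.ext hPv h1)
    rw [fderiv_radialExt (hs1 hs) t (hFd _), ← fderiv_slice (hFd _), real_inner_comm, hv, zero_smul,
      sub_zero] at h2
    by_contra hv0
    exact hF.imm t ht s hs v hv hv0 h2
  · rw [hmain s hs t ht, (hd s hs t _).1, (hd s hs t _).2.2, fderiv_radialExt (hs1 hs) t (hFd _),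
      inner_zero_right, zero_smul, sub_zero]
    have h1 := hasDerivAt_slice (hFd (s, t))
    have h2 := hnn s hs t ht
    have h3 : HasDerivAt (fun t' => (F (s, t')).1) _ t :=
      HasFDerivAt.comp_hasDerivAt t hasFDerivAt_fst h1
    have h4 : HasDerivAt (fun t' => (F (s, t')).2.2) _ t :=
      HasFDerivAt.comp_hasDerivAt t hasFDerivAt_snd
        (HasFDerivAt.comp_hasDerivAt t hasFDerivAt_snd h1)
    rw [h3.deriv, h4.deriv] at h2
    simp [hpdef, radialExt_apply (hs1 hs)] at h2 ⊢
    linarith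
  · simp [hqdef, radialExt_apply (hs1 hs), hF0 s hs]
  · simp [hqdef, hpdef, hudef, radialExt_apply (hs1 hs), hF0 s hs, sphGrad, add_comm]

end JetIsotopy

theorem nonneg_isotopy_jet_graph_to_jet_graph (m : ℕ) (hm : 2 ≤ m)
    (h f : EuclideanSpace ℝ (Fin m) → ℝ) (hh : ContDiff ℝ (⊤ : ℕ∞) h) (hf : ContDiff ℝ (⊤ : ℕ∞) f)
    (F : EuclideanSpace ℝ (Fin m) × ℝ → JetSp m)
    (hF : IsLegIsotopyJet m F) (hnn : NonnegJet m F)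
    (hF0 : ∀ s ∈ sph m, F (s, 0) = (s, sphGrad m h s, h s))
    (hF1 : jetSlice m F 1 = jetGraph m f) :
    ∀ q ∈ sph m, h q ≤ f q := by
  intro q hq
  refine le_of_forall_pos_le_add fun ε hε => ?_
  obtain ⟨s, hs, hsq, hle⟩ := exists_le_add_of_nonneg hh hF hnn hF0 hε hq
  have hmem : F (s, 1) ∈ jetGraph m f := hF1 ▸ mem_image_of_mem _ hs
  obtain ⟨q', -, hq'⟩ := hmem
  rw [← hq'] at hsq hle
  obtain rfl : q' = q := hsq
  exact hle
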